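/- arXiv:1512.09211 — 4 statements merged into one kernel-verified Lean document; each statement's English description precedes it below -/
import Mathlib

section
/- Theorem 1: Let N ≥ 3 and let |ψ⟩ be an N-qubit pure state on qubits A, B, C₁, …, C_{N−2}. Then C²(|ψ⟩_{AB|C₁…C_{N−2}}) ≥ max{ Σ_{i=1}^{N−2} [C²(ρ_{AC_i}) − C_a²(ρ_{BC_i})], Σ_{i=1}^{N−2} [C²(ρ_{BC_i}) − C_a²(ρ_{AC_i})] }, where ρ_{AC_i} and ρ_{BC_i} are the two-qubit reduced density matrices of |ψ⟩⟨ψ| and the two-qubit concurrences are taken with respect to the bipartition of the first listed qubit versus the second. -/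
open scoped BigOperators

noncomputable section

/-- Partial trace over the second tensor factor:
`(ptraceRight ρ) s s' = ∑ t, ρ (s,t) (s',t)`. -/
def ptraceRight {S T : Type*} [Fintype S] [Fintype T]
    (ρ : Matrix (S × T) (S × T) ℂ) : Matrix S S ℂ :=
  fun s s' => ∑ t : T, ρ (s, t) (s', t)

/-- Partial trace over the first tensor factor. -/
def ptraceLeft {S T : Type*} [Fintype S] [Fintype T]
    (ρ : Matrix (S × T) (S × T) ℂ) : Matrix T T ℂ :=
  fun t t' => ∑ s : S, ρ (s, t) (s, t')

/-- The density matrix `|ψ⟩⟨ψ|` of a (pure) state vector `ψ`. -/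
def pureDM {d : Type*} (ψ : d → ℂ) : Matrix d d ℂ :=
  fun x y => ψ x * (starRingEnd ℂ) (ψ y)

/-- `Tr(ρ²)` (real part) of a square matrix. -/
def trSq {S : Type*} [Fintype S] (ρ : Matrix S S ℂ) : ℝ :=
  ((ρ * ρ).trace).re

/-- Linear entropy `T(ρ) = 1 - Tr(ρ²)`. -/
def linEnt {S : Type*} [Fintype S] (ρ : Matrix S S ℂ) : ℝ :=
  1 - trSq ρ

/-- Concurrence of a bipartite pure state `ψ : S × T → ℂ` (with respect to the
bipartition `S | T`): `C(ψ) = √(2 (1 - Tr ρ_S²))`. -/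
def pureConc {S T : Type*} [Fintype S] [Fintype T] (ψ : S × T → ℂ) : ℝ :=
  Real.sqrt (2 * (1 - trSq (ptraceRight (pureDM ψ))))

/-- The set of average pure-state concurrences over all finite pure-state
ensembles realizing the bipartite density matrix `ρ`. -/
def concSet {S T : Type*} [Fintype S] [Fintype T]
    (ρ : Matrix (S × T) (S × T) ℂ) : Set ℝ :=
  { c | ∃ (n : ℕ) (p : Fin n → ℝ) (φ : Fin n → S × T → ℂ),
      (∀ i, 0 ≤ p i) ∧ (∑ i, p i = 1) ∧
      (∀ i, ∑ x, ‖φ i x‖ ^ 2 = 1) ∧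
      (ρ = ∑ i, (p i : ℂ) • pureDM (φ i)) ∧
      c = ∑ i, p i * pureConc (φ i) }

/-- Concurrence of a bipartite mixed state (convex-roof extension). -/
def conc {S T : Type*} [Fintype S] [Fintype T]
    (ρ : Matrix (S × T) (S × T) ℂ) : ℝ :=
  sInf (concSet ρ)

/-- Concurrence of assistance of a bipartite mixed state. -/
def concA {S T : Type*} [Fintype S] [Fintype T]
    (ρ : Matrix (S × T) (S × T) ℂ) : ℝ :=
  sSup (concSet ρ)

/-- Concurrence of an `N`-qubit pure state `ψ` across the cut given by the
predicate `P` (the qubits satisfying `P` versus the rest). -/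
def qubitCut {N : ℕ} (P : Fin N → Prop) [DecidablePred P]
    (ψ : (Fin N → Fin 2) → ℂ) : ℝ :=
  pureConc (fun x : ({i // P i} → Fin 2) × ({i // ¬ P i} → Fin 2) =>
    ψ ((Equiv.piEquivPiSubtypeProd P (fun _ => Fin 2)).symm x))

/-- Assemble a full `N`-qubit configuration from values `x` at qubit `u`,
`y` at qubit `v`, and `f` elsewhere. -/
def assemble2 {N : ℕ} (u v : Fin N) (x y : Fin 2)
    (f : {i : Fin N // i ≠ u ∧ i ≠ v} → Fin 2) : Fin N → Fin 2 :=
  fun i => if h : i = u then x else if h' : i = v then y else f ⟨i, h, h'⟩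

/-- The two-qubit reduced density matrix of the `N`-qubit pure state `ψ` on the
(ordered) pair of qubits `u, v`, obtained by tracing out all other qubits. -/
def rdm2 {N : ℕ} (u v : Fin N) (ψ : (Fin N → Fin 2) → ℂ) :
    Matrix (Fin 2 × Fin 2) (Fin 2 × Fin 2) ℂ :=
  fun x y => ∑ f : {i : Fin N // i ≠ u ∧ i ≠ v} → Fin 2,
    ψ (assemble2 u v x.1 x.2 f) * (starRingEnd ℂ) (ψ (assemble2 u v y.1 y.2 f))

/-- The reduced density matrix of the `N`-qubit pure state `ψ` obtained by
tracing out the single qubit `v`, organized as a bipartite state on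
qubit `u` versus all remaining qubits. -/
def rdm1Rest {N : ℕ} (u v : Fin N) (ψ : (Fin N → Fin 2) → ℂ) :
    Matrix (Fin 2 × ({i : Fin N // i ≠ u ∧ i ≠ v} → Fin 2))
           (Fin 2 × ({i : Fin N // i ≠ u ∧ i ≠ v} → Fin 2)) ℂ :=
  fun x y => ∑ t : Fin 2,
    ψ (assemble2 u v x.1 t x.2) * (starRingEnd ℂ) (ψ (assemble2 u v y.1 t y.2))

open Matrix
open scoped ComplexOrder

theorem isCompact_unitaryGroup (n : Type*) [Fintype n] [DecidableEq n] :
    IsCompact (Matrix.unitaryGroup n ℂ : Set (Matrix n n ℂ)) := by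
  have hK : IsCompact (Set.univ.pi fun _ : n => Set.univ.pi fun _ : n =>
      Metric.closedBall (0 : ℂ) 1) :=
    isCompact_univ_pi fun _ => isCompact_univ_pi fun _ => isCompact_closedBall _ _
  refine IsCompact.of_isClosed_subset hK ?_ ?_
  · have : (Matrix.unitaryGroup n ℂ : Set (Matrix n n ℂ)) = {A | A * star A = 1} := by
      ext A; exact Matrix.mem_unitaryGroup_iff
    rw [this]
    exact isClosed_eq (by fun_prop) continuous_const
  · intro U hU i _ j _
    simpa using entry_norm_bound_of_unitary hU i j

theorem eq_zero_of_rotation_bound {T I : ℝ}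
    (h : ∀ c s : ℝ, c ^ 2 + s ^ 2 = 1 → (c ^ 2 - s ^ 2) * T - 2 * c * s * I ≤ T) : I = 0 := by
  by_contra hI
  set r := Real.sqrt (I ^ 2 + (|T| + 1) ^ 2) with hr
  have hpos : 0 < I ^ 2 + (|T| + 1) ^ 2 := by positivity
  have hr0 : 0 < r := Real.sqrt_pos.2 hpos
  have hr2 : r ^ 2 = I ^ 2 + (|T| + 1) ^ 2 := Real.sq_sqrt hpos.le
  have := h ((|T| + 1) / r) (-I / r) (by field_simp; linarith)
  have h2 : ((|T| + 1) ^ 2 - I ^ 2) * T + 2 * (|T| + 1) * I * I ≤ T * r ^ 2 := by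
    have h3 := mul_le_mul_of_nonneg_right this (sq_nonneg r)
    have h4 : ((((|T| + 1) / r) ^ 2 - (-I / r) ^ 2) * T - 2 * ((|T| + 1) / r) * (-I / r) * I) *
        r ^ 2 = ((|T| + 1) ^ 2 - I ^ 2) * T + 2 * (|T| + 1) * I * I := by
      field_simp
      ring
    linarith
  rw [hr2] at h2
  have hI2 : 0 < I ^ 2 := by positivity
  nlinarith [le_abs_self T]

/-- A complex symmetric matrix maximizing the real part of the trace along its unitary
congruence orbit is real. -/
theorem im_eq_zero_of_trace_max {n : Type*} [Fintype n] [DecidableEq n] {σ : Matrix n n ℂ}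
    (hσ : σᵀ = σ)
    (hmax : ∀ U ∈ Matrix.unitaryGroup n ℂ, (Uᵀ * σ * U).trace.re ≤ σ.trace.re) (i j : n) :
    (σ i j).im = 0 := by
  have key : ∀ H : Matrix n n ℂ, Hᵀ = H → Hᴴ = H → H * H = 1 → (σ * H).trace.im = 0 := by
    intro H hT hH hHH
    refine eq_zero_of_rotation_bound (T := σ.trace.re) fun c s hcs => ?_
    have hcs' : (c : ℂ) ^ 2 + (s : ℂ) ^ 2 = 1 := by exact_mod_cast hcs
    set U : Matrix n n ℂ := (c : ℂ) • (1 : Matrix n n ℂ) + (Complex.I * s) • H with hU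
    have hUU : U ∈ Matrix.unitaryGroup n ℂ := by
      rw [Matrix.mem_unitaryGroup_iff]
      have : star U = (c : ℂ) • (1 : Matrix n n ℂ) - (Complex.I * s) • H := by
        rw [hU, star_eq_conjTranspose]
        simp [conjTranspose_add, conjTranspose_smul, hH, sub_eq_add_neg]
      rw [this, hU]
      simp only [mul_sub, add_mul, smul_mul_smul_comm, hHH, mul_one, one_mul]
      have h1 : (c : ℂ) * c - Complex.I * s * (Complex.I * s) = 1 := by
        linear_combination hcs' - (s : ℂ) ^ 2 * Complex.I_sq
      calc _ = ((c : ℂ) * c - Complex.I * s * (Complex.I * s)) • (1 : Matrix n n ℂ) := by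
            rw [sub_smul, mul_comm (Complex.I * (s : ℂ)) (c : ℂ)]; abel
        _ = 1 := by rw [h1, one_smul]
    have h := hmax U hUU
    have hUt : Uᵀ = U := by rw [hU]; simp [transpose_add, transpose_smul, hT]
    have hU2 : U * U = ((c : ℂ) ^ 2 - (s : ℂ) ^ 2) • (1 : Matrix n n ℂ) +
        (2 * c * s * Complex.I) • H := by
      rw [hU]
      simp only [mul_add, add_mul, smul_mul_smul_comm, hHH, mul_one, one_mul]
      have h1 : (c : ℂ) ^ 2 - (s : ℂ) ^ 2 = c * c + Complex.I * s * (Complex.I * s) := by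
        linear_combination - (s : ℂ) ^ 2 * Complex.I_sq
      have h2 : 2 * (c : ℂ) * s * Complex.I = c * (Complex.I * s) + Complex.I * s * c := by ring
      rw [h1, h2, add_smul, add_smul]
      abel
    have htr : (Uᵀ * σ * U).trace =
        ((c : ℂ) ^ 2 - (s : ℂ) ^ 2) * σ.trace + (2 * c * s * Complex.I) * (σ * H).trace := by
      rw [hUt, mul_assoc, trace_mul_comm, mul_assoc, hU2, mul_add, trace_add]
      simp
    rw [htr] at h
    have hre : (((c : ℂ) ^ 2 - (s : ℂ) ^ 2) * σ.trace +
        (2 * c * s * Complex.I) * (σ * H).trace).re =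
        (c ^ 2 - s ^ 2) * σ.trace.re - 2 * c * s * (σ * H).trace.im := by
      have h1 : (c : ℂ) ^ 2 - (s : ℂ) ^ 2 = ((c ^ 2 - s ^ 2 : ℝ) : ℂ) := by push_cast; ring
      have h2 : 2 * (c : ℂ) * s * Complex.I = ((2 * c * s : ℝ) : ℂ) * Complex.I := by
        push_cast; ring
      rw [h1, h2, Complex.add_re, Complex.re_ofReal_mul, mul_assoc, Complex.re_ofReal_mul,
        Complex.I_mul_re]
      ring
    rw [hre] at h
    exact h
  have htr : σ.trace.im = 0 := by simpa using key 1 (by simp) (by simp) (by simp)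
  have quad : ∀ v : n → ℝ, v ⬝ᵥ v = 2 →
      (∑ k, ∑ l, σ k l * (v l * v k : ℝ)).im = 0 := by
    intro v hv
    set w : n → ℂ := fun k => (v k : ℂ) with hw
    have hww : w ⬝ᵥ w = 2 := by
      have : ((v ⬝ᵥ v : ℝ) : ℂ) = 2 := by rw [hv]; norm_num
      rw [← this]
      simp [dotProduct, hw]
    have hsw : star w = w := by ext k; simp [hw]
    have := key (1 - vecMulVec w w) (by simp [transpose_sub, transpose_vecMulVec])
      (by simp [conjTranspose_sub, conjTranspose_vecMulVec, hsw])
      (by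
        rw [sub_mul, mul_sub, mul_sub, vecMulVec_mul_vecMulVec, hww]
        simp only [one_mul, mul_one]
        rw [vecMulVec_smul, two_smul]
        abel)
    rw [mul_sub, trace_sub, mul_one, Complex.sub_im, htr, zero_sub, neg_eq_zero] at this
    rw [← this]
    congr 1
    simp [trace, mul_apply, vecMulVec_apply, hw]
  have hdiag : ∀ i, (σ i i).im = 0 := by
    intro i
    have h := quad (Pi.single i (Real.sqrt 2)) (by simp)
    simpa [Pi.single_apply, Finset.sum_ite_eq, ite_mul, mul_ite] using h
  by_cases hij : i = j
  · rw [hij]; exact hdiag j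
  · have h := quad (Pi.single i 1 + Pi.single j 1) (by
      simp [dotProduct_add, hij, Ne.symm hij]; norm_num)
    have hsymm : σ j i = σ i j := congrFun (congrFun hσ i) j
    have : ∑ k, ∑ l, σ k l * (((Pi.single i 1 + Pi.single j 1 : n → ℝ) l *
        (Pi.single i 1 + Pi.single j 1 : n → ℝ) k : ℝ) : ℂ) =
        σ i i + σ j j + 2 * σ i j := by
      simp only [Pi.add_apply, Pi.single_apply, Complex.ofReal_mul, Complex.ofReal_add, mul_add,
        add_mul, Finset.sum_add_distrib]
      simp [apply_ite, hsymm]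
      ring
    rw [this] at h
    simp [hdiag] at h
    exact h

/-- Autonne–Takagi factorization of a complex symmetric matrix. -/
theorem exists_unitary_transpose_mul_mul_eq_diagonal {n : Type*} [Fintype n] [DecidableEq n]
    {τ : Matrix n n ℂ} (hτ : τᵀ = τ) :
    ∃ V ∈ Matrix.unitaryGroup n ℂ, ∃ μ : n → ℝ, (∀ i, 0 ≤ μ i) ∧
      Vᵀ * τ * V = diagonal fun i => (μ i : ℂ) := by
  obtain ⟨V, hV, hmax⟩ := (isCompact_unitaryGroup n).exists_isMaxOn ⟨1, one_mem _⟩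
    (f := fun V => (Vᵀ * τ * V).trace.re) (by fun_prop)
  set σ := Vᵀ * τ * V with hσdef
  have hσ : σᵀ = σ := by simp [hσdef, transpose_mul, hτ, mul_assoc]
  have hreal := im_eq_zero_of_trace_max hσ fun U hU => by
    have := hmax (mul_mem hV hU)
    simpa [hσdef, transpose_mul, mul_assoc] using this
  set A : Matrix n n ℝ := σ.map Complex.re with hA
  have hσA : σ = A.map Complex.ofReal := by
    ext i j
    apply Complex.ext <;> simp [hA, hreal]
  have hAH : A.IsHermitian := by
    ext i j
    have := congrFun (congrFun hσ i) j
    simp only [transpose_apply] at this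
    simp [hA, this]
  set O : Matrix n n ℝ := (hAH.eigenvectorUnitary : Matrix n n ℝ) with hO
  have hOu : star O * O = 1 := Unitary.coe_star_mul_self _
  have hspec : Oᵀ * A * O = diagonal hAH.eigenvalues := by
    have h := hAH.spectral_theorem
    rw [Unitary.conjStarAlgAut_apply] at h
    have hOt : Oᵀ = star O := by
      rw [star_eq_conjTranspose, conjTranspose_eq_transpose_of_trivial]
    rw [hOt]
    calc star O * A * O = star O * (O * diagonal (RCLike.ofReal ∘ hAH.eigenvalues) * star O) * O :=
          by rw [← h]
      _ = (star O * O) * diagonal (RCLike.ofReal ∘ hAH.eigenvalues) * (star O * O) := by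
          simp only [mul_assoc]
      _ = _ := by rw [hOu]; simp
  set Oc : Matrix n n ℂ := O.map Complex.ofReal with hOc
  have hOcu : Oc ∈ Matrix.unitaryGroup n ℂ := by
    rw [Matrix.mem_unitaryGroup_iff']
    have : star Oc = (star O).map Complex.ofReal := by ext i j; simp [hOc]
    rw [this, hOc]
    have h := congrArg (fun M : Matrix n n ℝ => M.map Complex.ofRealHom) hOu
    simp only [Matrix.map_mul] at h
    exact h.trans (by simp)
  have hspecc : Ocᵀ * σ * Oc = diagonal fun i => (hAH.eigenvalues i : ℂ) := by
    have h := congrArg (fun M : Matrix n n ℝ => M.map Complex.ofRealHom) hspec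
    simp only [Matrix.map_mul] at h
    rw [hσA]
    refine Eq.trans h ?_
    rw [diagonal_map (by simp)]
    rfl
  set p : n → ℂ := fun i => if 0 ≤ hAH.eigenvalues i then 1 else Complex.I with hp
  have hpu : diagonal p ∈ Matrix.unitaryGroup n ℂ := by
    rw [Matrix.mem_unitaryGroup_iff', star_eq_conjTranspose, diagonal_conjTranspose,
      diagonal_mul_diagonal, ← diagonal_one]
    congr 1
    ext i
    by_cases h : 0 ≤ hAH.eigenvalues i <;> simp [hp, h]
  refine ⟨V * Oc * diagonal p, mul_mem (mul_mem hV hOcu) hpu, fun i => |hAH.eigenvalues i|,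
    fun i => abs_nonneg _, ?_⟩
  calc (V * Oc * diagonal p)ᵀ * τ * (V * Oc * diagonal p)
      = diagonal p * (Ocᵀ * σ * Oc) * diagonal p := by
        simp [hσdef, transpose_mul, mul_assoc]
    _ = _ := by
        rw [hspecc, diagonal_mul_diagonal, diagonal_mul_diagonal]
        congr 1
        ext i
        by_cases h : 0 ≤ hAH.eigenvalues i
        · simp [hp, h, abs_of_nonneg h]
        · simp only [hp, h, if_false]
          rw [abs_of_neg (not_le.1 h)]
          push_cast
          linear_combination (hAH.eigenvalues i : ℂ) * Complex.I_sq

theorem mul_self_of_trace_eq_zero {M : Matrix (Fin 2) (Fin 2) ℂ} (hM : M.trace = 0) :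
    M * M = (-M.det) • (1 : Matrix (Fin 2) (Fin 2) ℂ) := by
  have h : M 1 1 = -M 0 0 := by
    rw [trace_fin_two] at hM
    linear_combination hM
  ext i j
  fin_cases i <;> fin_cases j <;>
    simp [mul_apply, Fin.sum_univ_two, det_fin_two, h] <;> ring

theorem det_of_trace_eq_zero_of_mul_self {M : Matrix (Fin 2) (Fin 2) ℂ} {z : ℂ}
    (hM : M.trace = 0) (h : M * M = z • (1 : Matrix (Fin 2) (Fin 2) ℂ)) : M.det = -z := by
  rw [mul_self_of_trace_eq_zero hM] at h
  have := congrFun (congrFun h 0) 0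
  simp at this
  linear_combination -this

theorem adjugate_mul_add_adjugate_mul (X Y : Matrix (Fin 2) (Fin 2) ℂ) :
    adjugate X * Y + adjugate Y * X =
      (X 0 0 * Y 1 1 + X 1 1 * Y 0 0 - X 0 1 * Y 1 0 - X 1 0 * Y 0 1) •
        (1 : Matrix (Fin 2) (Fin 2) ℂ) := by
  ext i j
  fin_cases i <;> fin_cases j <;>
    simp only [Matrix.add_apply, mul_apply, Fin.sum_univ_two, adjugate_fin_two, of_apply, Matrix.smul_apply] <;>
    simp <;> ring

section PauliFrame

variable {P Q R : Matrix (Fin 2) (Fin 2) ℂ}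

theorem trace_eq_zero_of_anticommute (hQ : Q * Q = 1) (hPQ : P * Q = -(Q * P)) :
    P.trace = 0 := by
  have h : P.trace = -P.trace := by
    calc P.trace = (P * Q * Q).trace := by rw [mul_assoc, hQ, mul_one]
      _ = -(Q * P * Q).trace := by rw [hPQ, neg_mul, trace_neg]
      _ = -P.trace := by rw [trace_mul_comm, ← mul_assoc, hQ, one_mul]
  linear_combination h / 2

theorem mul_add_mul_of_trace_eq_zero {X Y : Matrix (Fin 2) (Fin 2) ℂ}
    (hX : X.trace = 0) (hY : Y.trace = 0) :
    X * Y + Y * X = (X * Y).trace • (1 : Matrix (Fin 2) (Fin 2) ℂ) := by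
  have h1 : X 1 1 = -X 0 0 := by
    rw [trace_fin_two] at hX
    linear_combination hX
  have h2 : Y 1 1 = -Y 0 0 := by
    rw [trace_fin_two] at hY
    linear_combination hY
  ext i j
  fin_cases i <;> fin_cases j <;>
    simp [mul_apply, Fin.sum_univ_two, trace_fin_two, h1, h2] <;> ring

theorem eq_smul_one_of_commute {X : Matrix (Fin 2) (Fin 2) ℂ}
    (hP : P * P = 1) (hQ : Q * Q = 1) (hPQ : P * Q = -(Q * P))
    (hXP : X * P = P * X) (hXQ : X * Q = Q * X) :
    ∃ z : ℂ, X = z • (1 : Matrix (Fin 2) (Fin 2) ℂ) := by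
  have hPtr : P.trace = 0 := trace_eq_zero_of_anticommute hQ hPQ
  have hQtr : Q.trace = 0 := trace_eq_zero_of_anticommute hP (by rw [hPQ, neg_neg])
  set Y := X - (X.trace / 2) • (1 : Matrix (Fin 2) (Fin 2) ℂ) with hY
  have hYtr : Y.trace = 0 := by simp [hY, trace_fin_two]
  have scalar : ∀ S : Matrix (Fin 2) (Fin 2) ℂ, S.trace = 0 → S * S = 1 → Y * S = S * Y →
      Y = ((Y * S).trace / 2) • S := by
    intro S hS hSS hc
    have h := mul_add_mul_of_trace_eq_zero hYtr hS
    rw [← hc] at h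
    have h2 : (2 : ℂ) • (Y * S) = (Y * S).trace • (1 : Matrix (Fin 2) (Fin 2) ℂ) := by
      rw [two_smul]; exact h
    have h3 := congrArg (· * S) h2
    simp only [smul_mul_assoc, mul_assoc, hSS, mul_one, one_mul] at h3
    rw [div_eq_inv_mul, mul_smul, ← h3, smul_smul]
    norm_num
  have hYP : Y * P = P * Y := by simp [hY, sub_mul, mul_sub, hXP]
  have hYQ : Y * Q = Q * Y := by simp [hY, sub_mul, mul_sub, hXQ]
  set t := (Y * P).trace / 2 with ht
  have hYt : Y = t • P := scalar P hPtr hP hYP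
  have h0 : t • (P * Q) = 0 := by
    have h1 : t • (P * Q) = t • (Q * P) := by
      rw [hYt, smul_mul_assoc, mul_smul_comm] at hYQ
      exact hYQ
    have h2 : t • (P * Q) = -(t • (Q * P)) := by rw [hPQ, smul_neg]
    have h3 : (2 : ℂ) • (t • (P * Q)) = 0 := by
      rw [two_smul]
      nth_rewrite 1 [h1]
      rw [h2, add_neg_cancel]
    exact (smul_eq_zero.1 h3).resolve_left two_ne_zero
  have hY0 : Y = 0 := by
    have h1 := congrArg (· * Q) h0
    simp only [smul_mul_assoc, mul_assoc, hQ, mul_one, zero_mul] at h1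
    rw [hYt, h1]
  exact ⟨X.trace / 2, sub_eq_zero.1 hY0⟩

/-- Three anticommuting involutions of `ℂ²` are self-adjoint for a common inner product. -/
theorem exists_posDef_intertwining (hP : P * P = 1) (hQ : Q * Q = 1) (hR : R * R = 1)
    (hPQ : P * Q = -(Q * P)) (hPR : P * R = -(R * P)) (hQR : Q * R = -(R * Q)) :
    ∃ K : Matrix (Fin 2) (Fin 2) ℂ,
      K.PosDef ∧ P * K = K * Pᴴ ∧ Q * K = K * Qᴴ ∧ R * K = K * Rᴴ := by
  have hQP : Q * P = -(P * Q) := by rw [hPQ, neg_neg]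
  have hRP : R * P = -(P * R) := by rw [hPR, neg_neg]
  have hRQ : R * Q = -(Q * R) := by rw [hQR, neg_neg]
  have hPP' : ∀ M, P * (P * M) = M := fun M => by rw [← mul_assoc, hP, one_mul]
  have hQQ' : ∀ M, Q * (Q * M) = M := fun M => by rw [← mul_assoc, hQ, one_mul]
  have hRR' : ∀ M, R * (R * M) = M := fun M => by rw [← mul_assoc, hR, one_mul]
  have hQP' : ∀ M, Q * (P * M) = -(P * (Q * M)) := fun M => by
    rw [← mul_assoc, hQP, neg_mul, mul_assoc]
  have hRP' : ∀ M, R * (P * M) = -(P * (R * M)) := fun M => by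
    rw [← mul_assoc, hRP, neg_mul, mul_assoc]
  have hRQ' : ∀ M, R * (Q * M) = -(Q * (R * M)) := fun M => by
    rw [← mul_assoc, hRQ, neg_mul, mul_assoc]
  obtain ⟨z, hz⟩ := eq_smul_one_of_commute (X := P * Q * R) hP hQ hPQ
    (by simp only [mul_assoc, hRP, hQP', mul_neg, neg_neg])
    (by simp only [mul_assoc, hRQ, hQQ', hQP', mul_neg])
  have hzz : z * z = -1 := by
    have h : P * Q * R * (P * Q * R) = -1 := by
      simp only [mul_assoc, hRP', hRQ', hQP', hPP', hQQ', hR, mul_neg, neg_neg]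
    rw [hz, smul_mul_smul_comm, one_mul] at h
    have := congrFun (congrFun h 0) 0
    simpa using this
  have hzn : z * star z = 1 := by
    have h1 : ‖z‖ * ‖z‖ = 1 := by rw [← norm_mul, hzz]; simp
    rw [Complex.star_def, Complex.mul_conj, Complex.normSq_eq_norm_sq, sq, h1]
    simp
  have ePQ : P * Q = z • R := by
    have := congrArg (· * R) hz
    simpa [mul_assoc, hR] using this
  have eQR : Q * R = z • P := by
    have := congrArg (P * ·) hz
    simpa [mul_assoc, hPP'] using this
  have ePR : P * R = -(z • Q) := by
    have := congrArg (Q * ·) hz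
    simp only [mul_assoc, hQP', hQQ', mul_smul_comm, mul_one] at this
    rw [← this, neg_neg]
  set K : Matrix (Fin 2) (Fin 2) ℂ := 1 + P * Pᴴ + Q * Qᴴ + R * Rᴴ with hK
  have sm : ∀ M N : Matrix (Fin 2) (Fin 2) ℂ, (z • M) * (z • N)ᴴ = M * Nᴴ := by
    intro M N
    rw [conjTranspose_smul, smul_mul_smul_comm, hzn, one_smul]
  have inv : ∀ S : Matrix (Fin 2) (Fin 2) ℂ, S * S = 1 → S * K * Sᴴ = K → S * K = K * Sᴴ := by
    intro S hS h
    have hSh : Sᴴ * Sᴴ = 1 := by rw [← conjTranspose_mul, hS, conjTranspose_one]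
    calc S * K = S * K * Sᴴ * Sᴴ := by rw [mul_assoc (S * K), hSh, mul_one]
      _ = _ := by rw [h]
  have expand : ∀ S : Matrix (Fin 2) (Fin 2) ℂ, S * K * Sᴴ =
      S * Sᴴ + (S * P) * (S * P)ᴴ + (S * Q) * (S * Q)ᴴ + (S * R) * (S * R)ᴴ := by
    intro S
    simp only [hK, mul_add, add_mul, conjTranspose_mul, mul_assoc, mul_one]
  refine ⟨K, ?_, inv P hP ?_, inv Q hQ ?_, inv R hR ?_⟩
  · exact ((PosDef.one.add_posSemidef (posSemidef_self_mul_conjTranspose P)).add_posSemidef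
      (posSemidef_self_mul_conjTranspose Q)).add_posSemidef (posSemidef_self_mul_conjTranspose R)
  · rw [expand, hP, ePQ, ePR, conjTranspose_neg, neg_mul_neg, sm, sm, hK]
    simp only [conjTranspose_one, mul_one]
    abel
  · rw [expand, hQ, hQP, ePQ, eQR, conjTranspose_neg, neg_mul_neg, sm, sm, hK]
    simp only [conjTranspose_one, mul_one]
    abel
  · rw [expand, hR, hRP, hRQ, ePR, eQR, neg_neg, conjTranspose_neg, neg_mul_neg, sm, sm, hK]
    simp only [conjTranspose_one, mul_one]
    abel

end PauliFrame

theorem im_trace_eq_zero {n : Type*} [Fintype n] {H : Matrix n n ℂ} (hH : Hᴴ = H) :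
    H.trace.im = 0 := by
  have h := trace_conjTranspose H
  rw [hH] at h
  exact Complex.conj_eq_iff_im.1 h.symm

/-- For a frame of matrices orthogonal for the polarized determinant, some traceless Hermitian
`H` of determinant `-1` has an image with large negative determinant. -/
theorem exists_isHermitian_le_neg_det {A B C D : Matrix (Fin 2) (Fin 2) ℂ} {m₀ m₁ m₂ m₃ : ℝ}
    (h₀ : 0 < m₀) (h₁ : 0 < m₁) (h₂ : 0 < m₂) (h₃ : 0 < m₃)
    (hA : A.det = (m₀ / 2 : ℝ)) (hB : B.det = (m₁ / 2 : ℝ)) (hC : C.det = (m₂ / 2 : ℝ))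
    (hD : D.det = (m₃ / 2 : ℝ))
    (hAB : adjugate A * B + adjugate B * A = 0) (hAC : adjugate A * C + adjugate C * A = 0)
    (hAD : adjugate A * D + adjugate D * A = 0) (hBC : adjugate B * C + adjugate C * B = 0)
    (hBD : adjugate B * D + adjugate D * B = 0) (hCD : adjugate C * D + adjugate D * C = 0)
    {c : ℝ} (hc₁ : c ^ 2 ≤ (m₀ + m₁ - m₂ - m₃) ^ 2) (hc₂ : c ^ 2 ≤ (m₀ - m₁ - m₂ + m₃) ^ 2) :
    ∃ H : Matrix (Fin 2) (Fin 2) ℂ, Hᴴ = H ∧ H.trace = 0 ∧ H.det = -1 ∧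
      c ^ 2 ≤ -4 * (A * H * Aᴴ + B * H * Bᴴ + C * H * Cᴴ + D * H * Dᴴ).det.re := by
  have frame : ∀ (X : Matrix (Fin 2) (Fin 2) ℂ) (m : ℝ), 0 < m → X.det = (m / 2 : ℝ) →
      adjugate A * X + adjugate X * A = 0 →
      ∃ t g : ℂ, ∃ P, P = t • (adjugate A * X) ∧ P * P = 1 ∧ X = g • (A * P) ∧
        g * star g = ((m / m₀ : ℝ) : ℂ) := by
    intro X m hm hX hAX
    set r := Real.sqrt (m₀ * m) with hr
    have hr0 : 0 < r := Real.sqrt_pos.2 (by positivity)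
    have hr2 : (r : ℂ) ^ 2 = m₀ * m := by
      exact_mod_cast Real.sq_sqrt (by positivity : 0 ≤ m₀ * m)
    have hrc : (r : ℂ) ≠ 0 := by exact_mod_cast hr0.ne'
    have hmc : (m₀ : ℂ) ≠ 0 := by exact_mod_cast h₀.ne'
    refine ⟨Complex.I * 2 / r, -Complex.I * r / m₀, _, rfl, ?_, ?_, ?_⟩
    · have h1 : adjugate A * X * (adjugate A * X) =
          (-(m₀ * m / 4) : ℂ) • (1 : Matrix (Fin 2) (Fin 2) ℂ) := by
        have h2 : adjugate A * X = -(adjugate X * A) := eq_neg_of_add_eq_zero_left hAX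
        calc adjugate A * X * (adjugate A * X) = -(adjugate A * (X * adjugate X) * A) := by
              nth_rewrite 2 [h2]
              simp only [mul_neg, mul_assoc]
          _ = _ := by
              rw [mul_adjugate, mul_smul_comm, mul_one, smul_mul_assoc, adjugate_mul, hA, hX,
                smul_smul, ← neg_smul]
              congr 1
              push_cast
              ring
      rw [smul_mul_smul_comm, h1, smul_smul]
      have : Complex.I * 2 / r * (Complex.I * 2 / r) * (-(m₀ * m / 4) : ℂ) = 1 := by
        field_simp
        rw [hr2, Complex.I_sq]
        ring
      rw [this, one_smul]
    · rw [mul_smul_comm, ← mul_assoc, mul_adjugate, smul_mul_assoc, one_mul, smul_smul, smul_smul,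
        hA]
      have : -Complex.I * r / m₀ * (Complex.I * 2 / r) * ((m₀ / 2 : ℝ) : ℂ) = 1 := by
        push_cast
        field_simp
        rw [Complex.I_sq]
        ring
      rw [this, one_smul]
    · simp only [star_div₀, star_mul', star_neg, Complex.star_def, Complex.conj_I,
        Complex.conj_ofReal]
      push_cast
      field_simp
      rw [Complex.I_sq, hr2]
      ring
  have anti : ∀ (X Y : Matrix (Fin 2) (Fin 2) ℂ) (s t : ℂ),
      adjugate A * X + adjugate X * A = 0 → adjugate A * Y + adjugate Y * A = 0 →
      adjugate X * Y + adjugate Y * X = 0 →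
      s • (adjugate A * X) * (t • (adjugate A * Y)) =
        -(t • (adjugate A * Y) * (s • (adjugate A * X))) := by
    intro X Y s t hX hY hXY
    have aux : ∀ X Y : Matrix (Fin 2) (Fin 2) ℂ, adjugate A * X + adjugate X * A = 0 →
        adjugate A * X * (adjugate A * Y) = -(A.det • (adjugate X * Y)) := by
      intro X Y hX
      rw [eq_neg_of_add_eq_zero_left hX, neg_mul, mul_assoc, ← mul_assoc A, mul_adjugate,
        smul_mul_assoc, one_mul, mul_smul_comm]
    rw [smul_mul_smul_comm, smul_mul_smul_comm, aux X Y hX, aux Y X hY,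
      eq_neg_of_add_eq_zero_left hXY, mul_comm s t]
    simp
  obtain ⟨t₁, g₁, P, hPdef, hP, hBP, hg₁⟩ := frame B m₁ h₁ hB hAB
  obtain ⟨t₂, g₂, Q, hQdef, hQ, hCQ, hg₂⟩ := frame C m₂ h₂ hC hAC
  obtain ⟨t₃, g₃, R, hRdef, hR, hDR, hg₃⟩ := frame D m₃ h₃ hD hAD
  have hPQ : P * Q = -(Q * P) := by rw [hPdef, hQdef]; exact anti _ _ _ _ hAB hAC hBC
  have hPR : P * R = -(R * P) := by rw [hPdef, hRdef]; exact anti _ _ _ _ hAB hAD hBD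
  have hQR : Q * R = -(R * Q) := by rw [hQdef, hRdef]; exact anti _ _ _ _ hAC hAD hCD
  have hPtr : P.trace = 0 := trace_eq_zero_of_anticommute hQ hPQ
  have hRtr : R.trace = 0 := trace_eq_zero_of_anticommute hP (by rw [hPR, neg_neg])
  obtain ⟨K, hK, hPK, hQK, hRK⟩ := exists_posDef_intertwining hP hQ hR hPQ hPR hQR
  have hKh : Kᴴ = K := hK.isHermitian
  obtain ⟨k, hk, hKdet⟩ : ∃ k : ℝ, 0 < k ∧ K.det = k := by
    have := Complex.pos_iff.1 hK.det_pos
    exact ⟨K.det.re, this.1, Complex.ext (by simp) (by simp [← this.2])⟩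
  have hPKh : (P * K)ᴴ = P * K := by rw [conjTranspose_mul, hKh, hPK]
  have hRKh : (R * K)ᴴ = R * K := by rw [conjTranspose_mul, hKh, hRK]
  have hdet : ∀ a b : ℝ, (((a : ℂ) • P + (b : ℂ) • R) * K).det =
      ((-(a ^ 2 + b ^ 2) * k : ℝ) : ℂ) := by
    intro a b
    rw [det_mul, hKdet, det_of_trace_eq_zero_of_mul_self (z := (a : ℂ) ^ 2 + (b : ℂ) ^ 2)]
    · push_cast; ring
    · simp [trace_add, trace_smul, hPtr, hRtr]
    · simp only [mul_add, add_mul, smul_mul_smul_comm, hP, hR, hPR, add_smul, sq, smul_neg,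
        mul_comm (b : ℂ) (a : ℂ)]
      abel
  obtain ⟨α, β, hαβ, hαβtr⟩ : ∃ α β : ℝ, (α ^ 2 + β ^ 2) * k = 1 ∧
      α * (P * K).trace.re + β * (R * K).trace.re = 0 := by
    obtain ⟨a, b, hab, htr⟩ : ∃ a b : ℝ, 0 < a ^ 2 + b ^ 2 ∧
        a * (P * K).trace.re + b * (R * K).trace.re = 0 := by
      by_cases h : (P * K).trace.re = 0
      · exact ⟨1, 0, by norm_num, by simp [h]⟩
      · exact ⟨-(R * K).trace.re, (P * K).trace.re, by positivity, by ring⟩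
    set q := Real.sqrt ((a ^ 2 + b ^ 2) * k) with hq
    have hq0 : 0 < q := Real.sqrt_pos.2 (by positivity)
    have hq2 : q ^ 2 = (a ^ 2 + b ^ 2) * k := Real.sq_sqrt (by positivity)
    refine ⟨a / q, b / q, ?_, ?_⟩
    · field_simp
      linarith
    · field_simp
      linarith
  refine ⟨((α : ℂ) • P + (β : ℂ) • R) * K, ?_, ?_, ?_, ?_⟩
  · rw [add_mul, smul_mul_assoc, smul_mul_assoc, conjTranspose_add, conjTranspose_smul,
      conjTranspose_smul, hPKh, hRKh]
    simp
  · rw [add_mul, smul_mul_assoc, smul_mul_assoc, trace_add, trace_smul, trace_smul]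
    apply Complex.ext
    · simpa using hαβtr
    · simp [im_trace_eq_zero hPKh, im_trace_eq_zero hRKh]
  · rw [hdet, neg_mul, hαβ]
    simp
  · set H := ((α : ℂ) • P + (β : ℂ) • R) * K with hH
    have term : ∀ (X S : Matrix (Fin 2) (Fin 2) ℂ) (g : ℂ) (r : ℝ), X = g • (A * S) →
        g * star g = (r : ℂ) → S * K = K * Sᴴ →
        X * H * Xᴴ = A * ((r : ℂ) • (S * ((α : ℂ) • P + (β : ℂ) • R) * S * K)) * Aᴴ := by
      intro X S g r hX hg hS
      rw [hX, conjTranspose_smul, smul_mul_assoc, smul_mul_smul_comm, hg, conjTranspose_mul]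
      simp only [hH, mul_assoc, hS, mul_smul_comm, smul_mul_assoc]
    have e₁ := term B P g₁ _ hBP hg₁ hPK
    have e₂ := term C Q g₂ _ hCQ hg₂ hQK
    have e₃ := term D R g₃ _ hDR hg₃ hRK
    have s₁ : P * ((α : ℂ) • P + (β : ℂ) • R) * P = (α : ℂ) • P - (β : ℂ) • R := by
      simp only [mul_add, add_mul, mul_smul_comm, smul_mul_assoc, hP, hPR, one_mul, neg_mul,
        mul_assoc, mul_one]
      rw [smul_neg, sub_eq_add_neg]
    have s₂ : Q * ((α : ℂ) • P + (β : ℂ) • R) * Q = -((α : ℂ) • P) - (β : ℂ) • R := by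
      have hQP : Q * P = -(P * Q) := by rw [hPQ, neg_neg]
      simp only [mul_add, add_mul, mul_smul_comm, smul_mul_assoc, hQP, hQR, neg_mul,
        mul_assoc, hQ, mul_one]
      rw [smul_neg, smul_neg, sub_eq_add_neg]
    have s₃ : R * ((α : ℂ) • P + (β : ℂ) • R) * R = -((α : ℂ) • P) + (β : ℂ) • R := by
      have hRP : R * P = -(P * R) := by rw [hPR, neg_neg]
      simp only [mul_add, add_mul, mul_smul_comm, smul_mul_assoc, hRP, neg_mul, one_mul,
        mul_assoc, hR, mul_one]
      rw [smul_neg]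
    have hsum : A * H * Aᴴ + B * H * Bᴴ + C * H * Cᴴ + D * H * Dᴴ =
        A * ((((α * (1 + m₁ / m₀ - m₂ / m₀ - m₃ / m₀) : ℝ) : ℂ) • P +
          ((β * (1 - m₁ / m₀ - m₂ / m₀ + m₃ / m₀) : ℝ) : ℂ) • R) * K) * Aᴴ := by
      rw [e₁, e₂, e₃, s₁, s₂, s₃, ← add_mul, ← add_mul, ← add_mul, ← mul_add, ← mul_add,
        ← mul_add, hH, ← smul_mul_assoc, ← smul_mul_assoc, ← smul_mul_assoc, ← add_mul,
        ← add_mul, ← add_mul]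
      congr 3
      push_cast
      module
    have hAstar : A.det * Aᴴ.det = ((m₀ ^ 2 / 4 : ℝ) : ℂ) := by
      rw [det_conjTranspose, hA, Complex.star_def, Complex.conj_ofReal]
      push_cast
      ring
    rw [hsum, det_mul, det_mul, hdet, mul_right_comm, hAstar, ← Complex.ofReal_mul,
      Complex.ofReal_re]
    have hval : -4 * (m₀ ^ 2 / 4 * (-((α * (1 + m₁ / m₀ - m₂ / m₀ - m₃ / m₀)) ^ 2 +
        (β * (1 - m₁ / m₀ - m₂ / m₀ + m₃ / m₀)) ^ 2) * k)) =
        α ^ 2 * k * (m₀ + m₁ - m₂ - m₃) ^ 2 + β ^ 2 * k * (m₀ - m₁ - m₂ + m₃) ^ 2 := by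
      field_simp
    rw [hval]
    calc c ^ 2 = α ^ 2 * k * c ^ 2 + β ^ 2 * k * c ^ 2 := by linear_combination -c ^ 2 * hαβ
      _ ≤ _ := by gcongr

open scoped MatrixOrder Matrix.Norms.L2Operator in
theorem exists_mul_conjTranspose_eq {n : Type*} [Fintype n] [DecidableEq n] {ρ : Matrix n n ℂ}
    (hρ : ρ.PosSemidef) : ∃ F : Matrix n n ℂ, F * Fᴴ = ρ := by
  obtain ⟨B, hB⟩ := CStarAlgebra.nonneg_iff_eq_star_mul_self.mp hρ.nonneg
  exact ⟨Bᴴ, by rw [hB, conjTranspose_conjTranspose, star_eq_conjTranspose]⟩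

/-- The `k`-th column of `F`, read as a `2 × 2` matrix. -/
def colMat {κ : Type*} (F : Matrix (Fin 2 × Fin 2) κ ℂ) (k : κ) : Matrix (Fin 2) (Fin 2) ℂ :=
  fun a c => F (a, c) k

/-- The symmetric bilinear form whose quadratic form is twice the determinant. -/
def polarDet : Matrix (Fin 2 × Fin 2) (Fin 2 × Fin 2) ℂ :=
  fun x y => if x.1 ≠ y.1 ∧ x.2 ≠ y.2 then (if x.1 = x.2 then 1 else -1) else 0

/-- The operator on the first factor obtained by contracting the second factor of `ρ`
with `H`. -/
def steer (ρ : Matrix (Fin 2 × Fin 2) (Fin 2 × Fin 2) ℂ) (H : Matrix (Fin 2) (Fin 2) ℂ) :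
    Matrix (Fin 2) (Fin 2) ℂ :=
  fun a a' => ∑ c, ∑ c', ρ (a, c) (a', c') * H c c'

theorem transpose_polarDet : polarDetᵀ = polarDet := by
  ext ⟨a, b⟩ ⟨c, d⟩
  fin_cases a <;> fin_cases b <;> fin_cases c <;> fin_cases d <;> simp [polarDet]

theorem polarDet_mul_self : polarDet * polarDet = 1 := by
  ext ⟨a, b⟩ ⟨c, d⟩
  fin_cases a <;> fin_cases b <;> fin_cases c <;> fin_cases d <;>
    simp [polarDet, Matrix.mul_apply, Fintype.sum_prod_type]

theorem transpose_mul_polarDet_mul_apply {κ : Type*} (F : Matrix (Fin 2 × Fin 2) κ ℂ) (i j : κ) :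
    (Fᵀ * polarDet * F) i j = colMat F i 0 0 * colMat F j 1 1 + colMat F i 1 1 * colMat F j 0 0 -
      colMat F i 0 1 * colMat F j 1 0 - colMat F i 1 0 * colMat F j 0 1 := by
  simp [polarDet, Matrix.mul_apply, Fintype.sum_prod_type, colMat]
  ring

theorem two_mul_det_colMat {κ : Type*} (F : Matrix (Fin 2 × Fin 2) κ ℂ) (i : κ) :
    2 * (colMat F i).det = (Fᵀ * polarDet * F) i i := by
  rw [transpose_mul_polarDet_mul_apply, det_fin_two]
  ring

theorem steer_mul_conjTranspose {κ : Type*} [Fintype κ] (F : Matrix (Fin 2 × Fin 2) κ ℂ)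
    (H : Matrix (Fin 2) (Fin 2) ℂ) :
    steer (F * Fᴴ) H = ∑ k, colMat F k * H * (colMat F k)ᴴ := by
  ext a a'
  simp only [steer, Matrix.mul_apply, Matrix.sum_apply, Finset.sum_mul, conjTranspose_apply, colMat]
  rw [Finset.sum_comm, Finset.sum_comm]
  simp only [Fin.sum_univ_two, ← Finset.sum_add_distrib]
  refine Finset.sum_congr rfl fun k _ => ?_
  ring

/-- Rephasing the rows of a `4 × 4` Hadamard matrix. -/
theorem exists_unitary_sq_eq {p : Fin 2 × Fin 2 → ℂ} (hp : ∀ i, p i * star (p i) = 1) :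
    ∃ U ∈ unitaryGroup (Fin 2 × Fin 2) ℂ, ∀ i k, U i k ^ 2 = p i ^ 2 / 4 := by
  refine ⟨of fun i k => p i / 2 * ((-1) ^ (i.1.val * k.1.val + i.2.val * k.2.val)), ?_, ?_⟩
  · rw [mem_unitaryGroup_iff]
    ext ⟨a, b⟩ ⟨c, d⟩
    have h := hp (a, b)
    rw [Complex.star_def] at h
    fin_cases a <;> fin_cases b <;> fin_cases c <;> fin_cases d <;>
      simp [Matrix.mul_apply, Fintype.sum_prod_type, star_apply] at h ⊢ <;>
      linear_combination h
  · intro i k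
    have : ((-1 : ℂ) ^ (i.1.val * k.1.val + i.2.val * k.2.val)) ^ 2 = 1 := by
      rw [← pow_mul, mul_comm, pow_mul]; norm_num
    show (p i / 2 * _) ^ 2 = _
    rw [mul_pow, this]
    ring

theorem transpose_mul_diagonal_mul_apply {n : Type*} [Fintype n] [DecidableEq n] (U : Matrix n n ℂ)
    (d : n → ℂ) (k : n) : (Uᵀ * diagonal d * U) k k = ∑ i, U i k ^ 2 * d i := by
  rw [Matrix.mul_apply]
  simp only [mul_diagonal, transpose_apply]
  exact Finset.sum_congr rfl fun i _ => by ring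

theorem exists_factorization_of_posDef {ρ : Matrix (Fin 2 × Fin 2) (Fin 2 × Fin 2) ℂ}
    (hρ : ρ.PosDef) :
    ∃ F : Matrix (Fin 2 × Fin 2) (Fin 2 × Fin 2) ℂ, ∃ H : Matrix (Fin 2) (Fin 2) ℂ,
      F * Fᴴ = ρ ∧ Hᴴ = H ∧ H.trace = 0 ∧ H.det = -1 ∧
      (∑ k, 2 * ‖(colMat F k).det‖) ^ 2 ≤ -4 * (steer ρ H).det.re := by
  obtain ⟨F₀, hρF⟩ := exists_mul_conjTranspose_eq hρ.posSemidef
  have hdetF : F₀.det ≠ 0 := by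
    intro h
    have := hρ.det_pos
    rw [← hρF, det_mul, h, zero_mul] at this
    exact lt_irrefl _ this
  obtain ⟨V, hV, μ, hμ, hVμ⟩ := exists_unitary_transpose_mul_mul_eq_diagonal
    (τ := F₀ᵀ * polarDet * F₀)
    (by rw [transpose_mul, transpose_mul, transpose_transpose, transpose_polarDet, mul_assoc])
  set F := F₀ * V with hF
  have hFF : F * Fᴴ = ρ := by
    rw [hF, conjTranspose_mul, mul_assoc, ← mul_assoc V, ← star_eq_conjTranspose V,
      mem_unitaryGroup_iff.mp hV, one_mul, hρF]
  have hFμ : Fᵀ * polarDet * F = diagonal fun i => (μ i : ℂ) := by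
    rw [← hVμ, hF, transpose_mul]
    simp only [mul_assoc]
  have hμpos : ∀ i, 0 < μ i := by
    intro i
    refine lt_of_le_of_ne (hμ i) fun h0 => ?_
    have h1 := congrArg Matrix.det hFμ
    rw [det_mul, det_mul, det_transpose, det_diagonal,
      Finset.prod_eq_zero (Finset.mem_univ i) (by simp [← h0])] at h1
    have hVd : V.det ≠ 0 := by
      intro h
      have := congrArg Matrix.det (mem_unitaryGroup_iff.mp hV)
      rw [det_mul, h, zero_mul, det_one] at this
      exact zero_ne_one this
    have hGd : polarDet.det ≠ 0 := by
      intro h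
      have := congrArg Matrix.det polarDet_mul_self
      rw [det_mul, h, zero_mul, det_one] at this
      exact zero_ne_one this
    have hFd : F.det ≠ 0 := by rw [hF, det_mul]; exact mul_ne_zero hdetF hVd
    exact mul_ne_zero (mul_ne_zero hFd hGd) hFd h1
  have hdet : ∀ i, (colMat F i).det = (μ i / 2 : ℝ) := by
    intro i
    have := two_mul_det_colMat F i
    rw [hFμ, diagonal_apply_eq] at this
    push_cast
    linear_combination this / 2
  have hpol : ∀ i j, i ≠ j →
      adjugate (colMat F i) * colMat F j + adjugate (colMat F j) * colMat F i = 0 := by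
    intro i j hij
    rw [adjugate_mul_add_adjugate_mul, ← transpose_mul_polarDet_mul_apply, hFμ,
      diagonal_apply_ne _ hij, zero_smul]
  have hmain : ∀ p : Fin 2 × Fin 2 → ℂ, (∀ i, p i * star (p i) = 1) →
      ∀ s : ℝ, ∑ i, p i ^ 2 * μ i = s →
      s ^ 2 ≤ (μ (0, 0) + μ (0, 1) - μ (1, 0) - μ (1, 1)) ^ 2 →
      s ^ 2 ≤ (μ (0, 0) - μ (0, 1) - μ (1, 0) + μ (1, 1)) ^ 2 →
      ∃ F : Matrix (Fin 2 × Fin 2) (Fin 2 × Fin 2) ℂ, ∃ H : Matrix (Fin 2) (Fin 2) ℂ,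
        F * Fᴴ = ρ ∧ Hᴴ = H ∧ H.trace = 0 ∧ H.det = -1 ∧
        (∑ k, 2 * ‖(colMat F k).det‖) ^ 2 ≤ -4 * (steer ρ H).det.re := by
    intro p hp s hs h1 h2
    obtain ⟨U, hU, hUp⟩ := exists_unitary_sq_eq hp
    obtain ⟨H, hH, htr, hHd, hle⟩ := exists_isHermitian_le_neg_det (hμpos (0, 0)) (hμpos (0, 1))
      (hμpos (1, 0)) (hμpos (1, 1)) (hdet _) (hdet _) (hdet _) (hdet _)
      (hpol _ _ (by simp)) (hpol _ _ (by simp)) (hpol _ _ (by simp)) (hpol _ _ (by simp))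
      (hpol _ _ (by simp)) (hpol _ _ (by simp)) h1 h2
    refine ⟨F * U, H, ?_, hH, htr, hHd, ?_⟩
    · rw [conjTranspose_mul, mul_assoc, ← mul_assoc U, ← star_eq_conjTranspose U,
        mem_unitaryGroup_iff.mp hU, one_mul, hFF]
    · have hk : ∀ k, 2 * (colMat (F * U) k).det = ((s / 4 : ℝ) : ℂ) := by
        intro k
        have : (F * U)ᵀ * polarDet * (F * U) = Uᵀ * (diagonal fun i => (μ i : ℂ)) * U := by
          rw [← hFμ, transpose_mul]
          simp only [mul_assoc]
        rw [two_mul_det_colMat, this, transpose_mul_diagonal_mul_apply]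
        push_cast
        rw [← hs, Finset.sum_div]
        exact Finset.sum_congr rfl fun i _ => by rw [hUp]; ring
      have hk' : ∀ k, 2 * ‖(colMat (F * U) k).det‖ = |s| / 4 := by
        intro k
        have := congrArg norm (hk k)
        rw [norm_mul, Complex.norm_real, Real.norm_eq_abs, abs_div] at this
        simpa using this
      have hsum : ∑ k : Fin 2 × Fin 2, 2 * ‖(colMat (F * U) k).det‖ = |s| := by
        simp only [hk', Finset.sum_const, Finset.card_univ, Fintype.card_prod, Fintype.card_fin]
        simp
        ring
      rw [hsum, sq_abs, ← hFF, steer_mul_conjTranspose]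
      simpa [Fintype.sum_prod_type, add_assoc] using hle
  rcases le_total ((μ (0, 0) + μ (0, 1) - μ (1, 0) - μ (1, 1)) ^ 2)
    ((μ (0, 0) - μ (0, 1) - μ (1, 0) + μ (1, 1)) ^ 2) with h | h
  · refine hmain (fun i => if i.1 = 0 then 1 else Complex.I) ?_ _ ?_ le_rfl h
    · rintro ⟨a, b⟩
      fin_cases a <;> simp
    · simp [Fintype.sum_prod_type]
      ring
  · refine hmain (fun i => if i.1 = i.2 then 1 else Complex.I) ?_ _ ?_ h le_rfl
    · rintro ⟨a, b⟩
      fin_cases a <;> fin_cases b <;> simp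
    · simp [Fintype.sum_prod_type]
      ring

/-- `ρ` decomposes into pure (unnormalised) two-qubit states whose concurrences add up to
at most `c`. -/
def HasConcBound (ρ : Matrix (Fin 2 × Fin 2) (Fin 2 × Fin 2) ℂ) (c : ℝ) : Prop :=
  ∃ (κ : Type) (_ : Fintype κ) (F : Matrix (Fin 2 × Fin 2) κ ℂ),
    F * Fᴴ = ρ ∧ ∑ k, 2 * ‖(colMat F k).det‖ ≤ c

theorem HasConcBound.add {ρ ρ' : Matrix (Fin 2 × Fin 2) (Fin 2 × Fin 2) ℂ} {c c' : ℝ}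
    (h : HasConcBound ρ c) (h' : HasConcBound ρ' c') : HasConcBound (ρ + ρ') (c + c') := by
  obtain ⟨κ, _, F, rfl, hF⟩ := h
  obtain ⟨κ', _, F', rfl, hF'⟩ := h'
  refine ⟨κ ⊕ κ', inferInstance, fromCols F F', ?_, ?_⟩
  · rw [conjTranspose_fromCols_eq_fromRows_conjTranspose, fromCols_mul_fromRows]
  · rw [Fintype.sum_sum_type]
    exact add_le_add hF hF'

theorem mul_self_eq_one_of_det {H : Matrix (Fin 2) (Fin 2) ℂ} (htr : H.trace = 0)
    (hdet : H.det = -1) : H * H = 1 := by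
  rw [mul_self_of_trace_eq_zero htr, hdet, neg_neg, one_smul]

theorem norm_sq_le_of_mul_conjTranspose {m n : Type*} [Fintype n] (F : Matrix m n ℂ) (x : m)
    (k : n) : ‖F x k‖ ^ 2 ≤ ((F * Fᴴ) x x).re := by
  rw [Matrix.mul_apply, Complex.re_sum]
  have : ∀ j, (F x j * Fᴴ j x).re = ‖F x j‖ ^ 2 := by
    intro j
    rw [conjTranspose_apply, Complex.star_def, Complex.mul_conj, Complex.ofReal_re,
      Complex.normSq_eq_norm_sq]
  simp only [this]
  exact Finset.single_le_sum (f := fun j => ‖F x j‖ ^ 2) (fun j _ => sq_nonneg _)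
    (Finset.mem_univ k)

theorem isCompact_setOf_forall_norm_le (m n : Type*) (R : ℝ) :
    IsCompact {F : Matrix m n ℂ | ∀ x k, ‖F x k‖ ≤ R} := by
  have : {F : Matrix m n ℂ | ∀ x k, ‖F x k‖ ≤ R} = Set.univ.pi fun _ : m =>
      Set.univ.pi fun _ : n => Metric.closedBall (0 : ℂ) R := by
    ext F
    exact ⟨fun h x _ k _ => mem_closedBall_zero_iff.mpr (h x k),
      fun h x k => mem_closedBall_zero_iff.mp (h x trivial k trivial)⟩
  rw [this]
  exact isCompact_univ_pi fun _ => isCompact_univ_pi fun _ => isCompact_closedBall _ _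

theorem exists_factorization_of_posSemidef {ρ : Matrix (Fin 2 × Fin 2) (Fin 2 × Fin 2) ℂ}
    (hρ : ρ.PosSemidef) :
    ∃ F : Matrix (Fin 2 × Fin 2) (Fin 2 × Fin 2) ℂ, ∃ H : Matrix (Fin 2) (Fin 2) ℂ,
      F * Fᴴ = ρ ∧ Hᴴ = H ∧ H.trace = 0 ∧ H.det = -1 ∧
      (∑ k, 2 * ‖(colMat F k).det‖) ^ 2 ≤ -4 * (steer ρ H).det.re := by
  set R : ℝ := ∑ x, |(ρ x x).re| + 1
  have hR : 1 ≤ R := le_add_of_nonneg_left (Finset.sum_nonneg fun _ _ => abs_nonneg _)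
  let σ : ℝ → Matrix (Fin 2 × Fin 2) (Fin 2 × Fin 2) ℂ := fun t => ρ + (t : ℂ) • 1
  have hσ : Continuous σ := by fun_prop
  let S : Set (ℝ × Matrix (Fin 2 × Fin 2) (Fin 2 × Fin 2) ℂ × Matrix (Fin 2) (Fin 2) ℂ) :=
    {q | q.2.1 * q.2.1ᴴ = σ q.1 ∧ q.2.2ᴴ = q.2.2 ∧ q.2.2.trace = 0 ∧ q.2.2.det = -1 ∧
      (∑ k, 2 * ‖(colMat q.2.1 k).det‖) ^ 2 ≤ -4 * (steer (σ q.1) q.2.2).det.re}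
  have hS : IsClosed S := by
    have h1 : Continuous fun q : ℝ × Matrix (Fin 2 × Fin 2) (Fin 2 × Fin 2) ℂ ×
        Matrix (Fin 2) (Fin 2) ℂ => steer (σ q.1) q.2.2 := by
      unfold steer
      fun_prop
    have h2 : ∀ k, Continuous fun q : ℝ × Matrix (Fin 2 × Fin 2) (Fin 2 × Fin 2) ℂ ×
        Matrix (Fin 2) (Fin 2) ℂ => colMat q.2.1 k := by
      intro k
      unfold colMat
      fun_prop
    have h3 : IsClosed {q : ℝ × Matrix (Fin 2 × Fin 2) (Fin 2 × Fin 2) ℂ ×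
        Matrix (Fin 2) (Fin 2) ℂ |
        (∑ k, 2 * ‖(colMat q.2.1 k).det‖) ^ 2 ≤ -4 * (steer (σ q.1) q.2.2).det.re} :=
      isClosed_le (by fun_prop) (continuous_const.mul (Complex.continuous_re.comp h1.matrix_det))
    exact (isClosed_eq (by fun_prop) (by fun_prop)).inter
      ((isClosed_eq (by fun_prop) (by fun_prop)).inter
      ((isClosed_eq (by fun_prop) (by fun_prop)).inter
      ((isClosed_eq (by fun_prop) (by fun_prop)).inter h3)))
  have hbdd : ∀ q ∈ S, q.1 ∈ Set.Icc (0 : ℝ) 1 →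
      q ∈ Set.Icc (0 : ℝ) 1 ×ˢ {F : Matrix (Fin 2 × Fin 2) (Fin 2 × Fin 2) ℂ | ∀ x k, ‖F x k‖ ≤ R} ×ˢ
        {H : Matrix (Fin 2) (Fin 2) ℂ | ∀ x k, ‖H x k‖ ≤ 1} := by
    rintro ⟨t, F, H⟩ ⟨hF, hH, htr, hdet, -⟩ ht
    refine ⟨ht, fun x k => ?_, fun x k => ?_⟩
    · have h1 := norm_sq_le_of_mul_conjTranspose F x k
      have h2 : ((F * Fᴴ) x x).re = (ρ x x).re + t := by
        rw [show F * Fᴴ = σ t from hF]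
        simp [σ]
      have h3 : |(ρ x x).re| ≤ ∑ x, |(ρ x x).re| :=
        Finset.single_le_sum (f := fun x => |(ρ x x).re|) (fun _ _ => abs_nonneg _)
          (Finset.mem_univ x)
      have h4 := le_abs_self (ρ x x).re
      have h5 : ‖F x k‖ ^ 2 ≤ R := by linarith [ht.2]
      show ‖F x k‖ ≤ R
      nlinarith [norm_nonneg (F x k)]
    · refine entry_norm_bound_of_unitary (mem_unitaryGroup_iff.mpr ?_) x k
      rw [star_eq_conjTranspose]
      rw [show Hᴴ = H from hH]
      exact mul_self_eq_one_of_det htr hdet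
  have hK : IsCompact (S ∩ Prod.fst ⁻¹' Set.Icc (0 : ℝ) 1) :=
    (isCompact_Icc.prod ((isCompact_setOf_forall_norm_le _ _ R).prod
      (isCompact_setOf_forall_norm_le _ _ 1))).of_isClosed_subset
      (hS.inter (isClosed_Icc.preimage continuous_fst)) fun q hq => hbdd q hq.1 hq.2
  have himg := (hK.image continuous_fst).isClosed
  have hsub : Set.Ioo (0 : ℝ) 1 ⊆ Prod.fst '' (S ∩ Prod.fst ⁻¹' Set.Icc (0 : ℝ) 1) := by
    intro t ht
    have hpd : (σ t).PosDef := by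
      exact PosDef.posSemidef_add hρ (PosDef.one.smul (by exact_mod_cast ht.1))
    obtain ⟨F, H, h⟩ := exists_factorization_of_posDef hpd
    exact ⟨(t, F, H), ⟨h, ⟨ht.1.le, ht.2.le⟩⟩, rfl⟩
  have h0 : (0 : ℝ) ∈ closure (Set.Ioo (0 : ℝ) 1) := by
    rw [closure_Ioo zero_ne_one]
    exact ⟨le_rfl, zero_le_one⟩
  obtain ⟨⟨t, F, H⟩, ⟨h, -⟩, ht⟩ := closure_minimal hsub himg h0
  obtain rfl : t = 0 := ht
  have hσ0 : σ 0 = ρ := by simp [σ]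
  rw [← hσ0]
  exact ⟨F, H, h⟩

theorem exists_unitary_eq_smul {H : Matrix (Fin 2) (Fin 2) ℂ} (hH : Hᴴ = H) (htr : H.trace = 0)
    (hdet : H.det = -1) :
    ∃ U ∈ unitaryGroup (Fin 2) ℂ, ∃ e : ℂ, e ^ 2 = 1 ∧
      H = e • of fun c c' => U c 0 * star (U c' 0) - U c 1 * star (U c' 1) := by
  have hH' : H.IsHermitian := hH
  have hs := hH'.spectral_theorem
  have htr' := hH'.trace_eq_sum_eigenvalues
  have hdet' := hH'.det_eq_prod_eigenvalues
  rw [htr, Fin.sum_univ_two] at htr'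
  rw [hdet, Fin.prod_univ_two] at hdet'
  refine ⟨hH'.eigenvectorUnitary, hH'.eigenvectorUnitary.2, (hH'.eigenvalues 0 : ℂ), ?_, ?_⟩
  · linear_combination hdet' - (hH'.eigenvalues 0 : ℂ) * htr'
  · have h1 : (hH'.eigenvalues 1 : ℂ) = -(hH'.eigenvalues 0 : ℂ) := by linear_combination -htr'
    ext c c'
    conv_lhs => rw [hs]
    simp [Unitary.conjStarAlgAut_apply, Matrix.mul_apply, diagonal, star_apply]
    rw [h1]
    ring

theorem exists_steer_bound {ρ : Matrix (Fin 2 × Fin 2) (Fin 2 × Fin 2) ℂ} (hρ : ρ.PosSemidef) :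
    ∃ c, 0 ≤ c ∧ HasConcBound ρ c ∧ ∃ U ∈ unitaryGroup (Fin 2) ℂ,
      c ^ 2 ≤ -4 * (steer ρ (of fun c c' => U c 0 * star (U c' 0) - U c 1 * star (U c' 1))).det.re := by
  obtain ⟨F, H, hF, hH, htr, hdet, hle⟩ := exists_factorization_of_posSemidef hρ
  obtain ⟨U, hU, e, he, rfl⟩ := exists_unitary_eq_smul hH htr hdet
  refine ⟨_, Finset.sum_nonneg fun k _ => by positivity, ⟨_, inferInstance, F, hF, le_rfl⟩, U, hU,
    hle.trans_eq ?_⟩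
  have : ∀ H, steer ρ (e • H) = e • steer ρ H := by
    intro H
    ext a a'
    simp only [steer, Matrix.smul_apply, smul_eq_mul, Finset.mul_sum]
    exact Finset.sum_congr rfl fun _ _ => Finset.sum_congr rfl fun _ _ => by ring
  rw [this, det_smul, Fintype.card_fin, he, one_mul]

theorem sum_add_sq_le_add_sq {ι : Type*} [Fintype ι] {u v : ι → ℝ} {p q : ℝ} (hp : 0 ≤ p)
    (hq : 0 ≤ q) (hu : ∑ j, u j ^ 2 ≤ p ^ 2) (hv : ∑ j, v j ^ 2 ≤ q ^ 2) :
    ∑ j, (u j + v j) ^ 2 ≤ (p + q) ^ 2 := by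
  have h : ∑ j, u j * v j ≤ p * q := by
    refine abs_le_of_sq_le_sq' ?_ (mul_nonneg hp hq) |>.2
    calc (∑ j, u j * v j) ^ 2 ≤ (∑ j, u j ^ 2) * ∑ j, v j ^ 2 :=
          Finset.sum_mul_sq_le_sq_mul_sq _ _ _
      _ ≤ p ^ 2 * q ^ 2 :=
          mul_le_mul hu hv (Finset.sum_nonneg fun _ _ => sq_nonneg _) (sq_nonneg _)
      _ = (p * q) ^ 2 := by ring
  have : ∑ j, (u j + v j) ^ 2 = ∑ j, u j ^ 2 + 2 * ∑ j, u j * v j + ∑ j, v j ^ 2 := by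
    rw [Finset.mul_sum, ← Finset.sum_add_distrib, ← Finset.sum_add_distrib]
    exact Finset.sum_congr rfl fun _ _ => by ring
  rw [this]
  linarith

theorem sum_fin_succ_arrow {n : ℕ} {α M : Type*} [Fintype α] [AddCommMonoid M]
    (F : (Fin (n + 1) → α) → M) : ∑ f, F f = ∑ a, ∑ g : Fin n → α, F (Fin.cons a g) := by
  rw [← Fintype.sum_prod_type']
  exact (Fintype.sum_equiv (Fin.consEquiv fun _ => α) _ _ fun _ => rfl).symm

/-- For an unnormalised state `φ` of a qubit and `n` further qubits, the reduced operator on the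
first qubit and the `j`-th of the further ones. -/
def pairRed {n : ℕ} (j : Fin n) (φ : Matrix (Fin 2) (Fin n → Fin 2) ℂ) :
    Matrix (Fin 2 × Fin 2) (Fin 2 × Fin 2) ℂ :=
  fun x y => ∑ f : Fin n → Fin 2,
    if f j = x.2 then φ x.1 f * star (φ y.1 (Function.update f j y.2)) else 0

/-- The state left after projecting the first of the further qubits on the conjugate of the
`k`-th column of `U`. -/
def postMeas {n : ℕ} (U : Matrix (Fin 2) (Fin 2) ℂ) (k : Fin 2)
    (φ : Matrix (Fin 2) (Fin (n + 1) → Fin 2) ℂ) : Matrix (Fin 2) (Fin n → Fin 2) ℂ :=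
  fun a g => ∑ c, U c k * φ a (Fin.cons c g)

theorem pairRed_zero_apply {n : ℕ} (φ : Matrix (Fin 2) (Fin (n + 1) → Fin 2) ℂ)
    (x y : Fin 2 × Fin 2) :
    pairRed 0 φ x y = ∑ g : Fin n → Fin 2, φ x.1 (Fin.cons x.2 g) * star (φ y.1 (Fin.cons y.2 g)) := by
  rw [pairRed, sum_fin_succ_arrow]
  simp only [Fin.cons_zero, Fin.update_cons_zero]
  rw [Finset.sum_comm]
  simp

theorem posSemidef_pairRed_zero {n : ℕ} (φ : Matrix (Fin 2) (Fin (n + 1) → Fin 2) ℂ) :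
    (pairRed 0 φ).PosSemidef := by
  have : pairRed 0 φ = (of fun (x : Fin 2 × Fin 2) (g : Fin n → Fin 2) => φ x.1 (Fin.cons x.2 g)) *
      (of fun (x : Fin 2 × Fin 2) (g : Fin n → Fin 2) => φ x.1 (Fin.cons x.2 g))ᴴ := by
    ext x y
    simp [pairRed_zero_apply, Matrix.mul_apply]
  rw [this]
  exact posSemidef_self_mul_conjTranspose _

theorem postMeas_mul_conjTranspose {n : ℕ} (U : Matrix (Fin 2) (Fin 2) ℂ) (k : Fin 2)
    (φ : Matrix (Fin 2) (Fin (n + 1) → Fin 2) ℂ) :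
    postMeas U k φ * (postMeas U k φ)ᴴ =
      steer (pairRed 0 φ) (of fun c c' => U c k * star (U c' k)) := by
  ext a a'
  simp only [Matrix.mul_apply, conjTranspose_apply, postMeas, steer, pairRed_zero_apply,
    Fin.sum_univ_two, Finset.sum_mul, ← Finset.sum_add_distrib, of_apply]
  refine Finset.sum_congr rfl fun g _ => ?_
  simp only [star_add, star_mul']
  ring

theorem steer_pairRed_zero_one {n : ℕ} (φ : Matrix (Fin 2) (Fin (n + 1) → Fin 2) ℂ) :
    steer (pairRed 0 φ) 1 = φ * φᴴ := by
  ext a a'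
  simp [steer, Matrix.mul_apply, sum_fin_succ_arrow, pairRed_zero_apply]

theorem mul_star_add_mul_star {U : Matrix (Fin 2) (Fin 2) ℂ} (hU : U ∈ unitaryGroup (Fin 2) ℂ)
    (c c' : Fin 2) :
    U c 0 * star (U c' 0) + U c 1 * star (U c' 1) = (1 : Matrix (Fin 2) (Fin 2) ℂ) c c' := by
  rw [← mem_unitaryGroup_iff.mp hU, Matrix.mul_apply, Fin.sum_univ_two, star_apply, star_apply]

theorem postMeas_add {n : ℕ} {U : Matrix (Fin 2) (Fin 2) ℂ} (hU : U ∈ unitaryGroup (Fin 2) ℂ)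
    (φ : Matrix (Fin 2) (Fin (n + 1) → Fin 2) ℂ) :
    postMeas U 0 φ * (postMeas U 0 φ)ᴴ + postMeas U 1 φ * (postMeas U 1 φ)ᴴ = φ * φᴴ := by
  rw [postMeas_mul_conjTranspose, postMeas_mul_conjTranspose, ← steer_pairRed_zero_one]
  ext a a'
  simp only [steer, Matrix.add_apply, ← Finset.sum_add_distrib, of_apply, ← mul_add,
    mul_star_add_mul_star hU]

theorem postMeas_sub {n : ℕ} (U : Matrix (Fin 2) (Fin 2) ℂ)
    (φ : Matrix (Fin 2) (Fin (n + 1) → Fin 2) ℂ) :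
    postMeas U 0 φ * (postMeas U 0 φ)ᴴ - postMeas U 1 φ * (postMeas U 1 φ)ᴴ =
      steer (pairRed 0 φ) (of fun c c' => U c 0 * star (U c' 0) - U c 1 * star (U c' 1)) := by
  rw [postMeas_mul_conjTranspose, postMeas_mul_conjTranspose]
  ext a a'
  simp only [steer, Matrix.sub_apply, ← Finset.sum_sub_distrib, of_apply, ← mul_sub]

theorem pairRed_succ {n : ℕ} {U : Matrix (Fin 2) (Fin 2) ℂ} (hU : U ∈ unitaryGroup (Fin 2) ℂ)
    (j : Fin n) (φ : Matrix (Fin 2) (Fin (n + 1) → Fin 2) ℂ) :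
    pairRed j.succ φ = pairRed j (postMeas U 0 φ) + pairRed j (postMeas U 1 φ) := by
  ext x y
  rw [Matrix.add_apply, pairRed, sum_fin_succ_arrow, Finset.sum_comm]
  simp only [pairRed, ← Finset.sum_add_distrib]
  refine Finset.sum_congr rfl fun g _ => ?_
  simp only [Fin.cons_succ, ← Fin.cons_update]
  split_ifs
  · have h := fun c c' => mul_star_add_mul_star hU c c'
    simp only [Fin.sum_univ_two, postMeas, star_add, star_mul']
    have h00 := h 0 0
    have h01 := h 0 1
    have h10 := h 1 0
    have h11 := h 1 1
    simp only [one_apply_eq, ne_eq, zero_ne_one, one_ne_zero, not_false_eq_true,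
      one_apply_ne] at h00 h01 h10 h11
    set u := Function.update g j y.2
    linear_combination (-(φ x.1 (Fin.cons 0 g) * star (φ y.1 (Fin.cons 0 u)))) * h00 -
      (φ x.1 (Fin.cons 0 g) * star (φ y.1 (Fin.cons 1 u))) * h01 -
      (φ x.1 (Fin.cons 1 g) * star (φ y.1 (Fin.cons 0 u))) * h10 -
      (φ x.1 (Fin.cons 1 g) * star (φ y.1 (Fin.cons 1 u))) * h11
  · simp

theorem det_add_add_det_sub (X Y : Matrix (Fin 2) (Fin 2) ℂ) :
    (X + Y).det + (X - Y).det = 2 * X.det + 2 * Y.det := by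
  simp only [det_fin_two, Matrix.add_apply, Matrix.sub_apply]
  ring

theorem det_mul_conjTranspose_nonneg {m : Type*} [Fintype m] (φ : Matrix (Fin 2) m ℂ) :
    0 ≤ (φ * φᴴ).det.re :=
  (Complex.le_def.mp (posSemidef_self_mul_conjTranspose φ).det_nonneg).1

/-- Monogamy of the concurrence for (unnormalised) pure states. -/
theorem exists_monogamy_bound {n : ℕ} (φ : Matrix (Fin 2) (Fin n → Fin 2) ℂ) :
    ∃ c : Fin n → ℝ, (∀ j, 0 ≤ c j) ∧ (∀ j, HasConcBound (pairRed j φ) (c j)) ∧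
      ∑ j, c j ^ 2 ≤ 4 * (φ * φᴴ).det.re := by
  induction n with
  | zero =>
    refine ⟨fun _ => 0, fun _ => le_rfl, fun j => j.elim0, ?_⟩
    rw [Finset.univ_eq_empty, Finset.sum_empty]
    have := det_mul_conjTranspose_nonneg φ
    positivity
  | succ n ih =>
    obtain ⟨c₀, hc₀, hb, U, hU, hle⟩ := exists_steer_bound (posSemidef_pairRed_zero φ)
    obtain ⟨u, hu, hbu, hu'⟩ := ih (postMeas U 0 φ)
    obtain ⟨v, hv, hbv, hv'⟩ := ih (postMeas U 1 φ)
    have hx := det_mul_conjTranspose_nonneg (postMeas U 0 φ)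
    have hy := det_mul_conjTranspose_nonneg (postMeas U 1 φ)
    have hdet := congrArg Complex.re (det_add_add_det_sub (postMeas U 0 φ * (postMeas U 0 φ)ᴴ)
      (postMeas U 1 φ * (postMeas U 1 φ)ᴴ))
    rw [postMeas_add hU, postMeas_sub] at hdet
    simp only [Complex.add_re, Complex.mul_re, Complex.re_ofNat, Complex.im_ofNat, zero_mul,
      sub_zero] at hdet
    set x := (postMeas U 0 φ * (postMeas U 0 φ)ᴴ).det.re
    set y := (postMeas U 1 φ * (postMeas U 1 φ)ᴴ).det.re
    have hxs := Real.sq_sqrt hx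
    have hys := Real.sq_sqrt hy
    have hsum := sum_add_sq_le_add_sq (p := 2 * √x) (q := 2 * √y) (by positivity) (by positivity)
      (hu'.trans_eq (by rw [mul_pow, hxs]; norm_num)) (hv'.trans_eq (by rw [mul_pow, hys]; norm_num))
    refine ⟨Fin.cons c₀ fun j => u j + v j, ?_, ?_, ?_⟩
    · exact Fin.cases hc₀ fun j => add_nonneg (hu j) (hv j)
    · refine Fin.cases hb fun j => ?_
      rw [pairRed_succ hU, Fin.cons_succ]
      exact (hbu j).add (hbv j)
    · rw [Fin.sum_univ_succ]
      simp only [Fin.cons_zero, Fin.cons_succ]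
      nlinarith [sq_nonneg (√x - √y)]

theorem trace_mul_self_mul_conjTranspose {m n : Type*} [Fintype m] [Fintype n]
    (X Y : Matrix m n ℂ) :
    (X * Yᴴ * (X * Yᴴ)ᴴ).trace = (Xᴴ * X * (Yᴴ * Y)).trace := by
  rw [conjTranspose_mul, conjTranspose_conjTranspose, trace_mul_comm (Xᴴ * X), Matrix.mul_assoc X,
    trace_mul_comm X]
  simp only [Matrix.mul_assoc]

theorem trace_mul_conjTranspose_eq_sum {m n : Type*} [Fintype m] [Fintype n] (X : Matrix m n ℂ) :
    (X * Xᴴ).trace = ((∑ i, ∑ j, ‖X i j‖ ^ 2 : ℝ) : ℂ) := by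
  simp [trace, Matrix.mul_apply, Complex.mul_conj, Complex.normSq_eq_norm_sq]

theorem sum_norm_sq_mul_conjTranspose {m n : Type*} [Fintype m] [Fintype n]
    (X Y : Matrix m n ℂ) :
    ∑ i, ∑ j, ‖(X * Yᴴ) i j‖ ^ 2 = (Xᴴ * X * (Yᴴ * Y)).trace.re := by
  rw [← trace_mul_self_mul_conjTranspose, trace_mul_conjTranspose_eq_sum, Complex.ofReal_re]

theorem trace_re_sq_le {n : Type*} [Fintype n] (R S : Matrix n n ℂ) :
    (R * S).trace.re ^ 2 ≤ (∑ i, ∑ j, ‖R i j‖ ^ 2) * ∑ i, ∑ j, ‖S i j‖ ^ 2 := by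
  have h : ‖(R * S).trace‖ ≤ ∑ x : n × n, ‖R x.1 x.2‖ * ‖S x.2 x.1‖ := by
    rw [Fintype.sum_prod_type]
    refine (norm_sum_le _ _).trans (Finset.sum_le_sum fun i _ => ?_)
    rw [diag_apply, Matrix.mul_apply]
    exact (norm_sum_le _ _).trans_eq (Finset.sum_congr rfl fun j _ => norm_mul _ _)
  calc (R * S).trace.re ^ 2 ≤ ‖(R * S).trace‖ ^ 2 :=
        sq_le_sq.mpr ((Complex.abs_re_le_norm _).trans (le_abs_self _))
    _ ≤ (∑ x : n × n, ‖R x.1 x.2‖ * ‖S x.2 x.1‖) ^ 2 := by gcongr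
    _ ≤ (∑ x : n × n, ‖R x.1 x.2‖ ^ 2) * ∑ x : n × n, ‖S x.2 x.1‖ ^ 2 :=
        Finset.sum_mul_sq_le_sq_mul_sq _ _ _
    _ = _ := by
        rw [Fintype.sum_prod_type, Fintype.sum_prod_type_right]

theorem four_mul_det_mul_conjTranspose {m : Type*} [Fintype m] (M : Matrix (Fin 2) m ℂ) :
    4 * (M * Mᴴ).det.re = 2 * ((∑ i, ∑ j, ‖M i j‖ ^ 2) ^ 2 - ∑ i, ∑ j, ‖(M * Mᴴ) i j‖ ^ 2) := by
  have h1 := trace_mul_conjTranspose_eq_sum M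
  have h2 := trace_mul_conjTranspose_eq_sum (M * Mᴴ)
  have h3 : (M * Mᴴ)ᴴ = M * Mᴴ := by rw [conjTranspose_mul, conjTranspose_conjTranspose]
  rw [h3] at h2
  set X := M * Mᴴ
  have h4 : 4 * X.det = 2 * (X.trace ^ 2 - (X * X).trace) := by
    simp only [det_fin_two, trace_fin_two, Matrix.mul_apply, Fin.sum_univ_two]
    ring
  rw [h1, h2] at h4
  rw [show 4 * X.det.re = (4 * X.det).re by simp]
  exact_mod_cast congrArg Complex.re h4

theorem pureConc_eq {ψ : Fin 2 × Fin 2 → ℂ} (hψ : ∑ x, ‖ψ x‖ ^ 2 = 1) :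
    pureConc ψ = 2 * ‖(of fun a c => ψ (a, c)).det‖ := by
  set M : Matrix (Fin 2) (Fin 2) ℂ := of fun a c => ψ (a, c) with hM
  have h1 : ptraceRight (pureDM ψ) = M * Mᴴ := by
    ext a a'
    simp [ptraceRight, pureDM, Matrix.mul_apply, hM]
  have h2 := four_mul_det_mul_conjTranspose M
  have h3 : ∑ i, ∑ j, ‖M i j‖ ^ 2 = 1 := by
    rw [← hψ, Fintype.sum_prod_type]
    rfl
  have h4 : trSq (M * Mᴴ) = ∑ i, ∑ j, ‖(M * Mᴴ) i j‖ ^ 2 := by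
    have h := trace_mul_conjTranspose_eq_sum (M * Mᴴ)
    rw [conjTranspose_mul, conjTranspose_conjTranspose] at h
    rw [trSq, h, Complex.ofReal_re]
  have h5 : (M * Mᴴ).det.re = ‖M.det‖ ^ 2 := by
    rw [det_mul, det_conjTranspose, Complex.star_def, Complex.mul_conj, Complex.ofReal_re,
      Complex.normSq_eq_norm_sq]
  rw [pureConc, h1, h4]
  rw [h3, one_pow, h5] at h2
  rw [← h2, show 4 * ‖M.det‖ ^ 2 = (2 * ‖M.det‖) ^ 2 by ring]
  exact Real.sqrt_sq (by positivity)

theorem exists_normalized (v : Fin 2 × Fin 2 → ℂ) :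
    ∃ φ : Fin 2 × Fin 2 → ℂ, ∑ x, ‖φ x‖ ^ 2 = 1 ∧
      ∀ x, v x = ((√(∑ x, ‖v x‖ ^ 2) : ℝ) : ℂ) * φ x := by
  have hp : 0 ≤ ∑ x, ‖v x‖ ^ 2 := Finset.sum_nonneg fun _ _ => sq_nonneg _
  rcases hp.eq_or_lt with h | h
  · refine ⟨Pi.single 0 1, ?_, fun x => ?_⟩
    · rw [Finset.sum_eq_single 0] <;> simp +contextual
    · have := (Finset.sum_eq_zero_iff_of_nonneg fun _ _ => sq_nonneg _).mp h.symm x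
        (Finset.mem_univ x)
      rw [← h, Real.sqrt_zero, Complex.ofReal_zero, zero_mul]
      simpa using this
  · have hs := Real.sqrt_pos.mpr h
    refine ⟨fun x => v x / ((√(∑ x, ‖v x‖ ^ 2) : ℝ) : ℂ), ?_, fun x => ?_⟩
    · simp only [norm_div, Complex.norm_real, Real.norm_eq_abs, div_pow, sq_abs,
        ← Finset.sum_div, Real.sq_sqrt hp]
      exact div_self h.ne'
    · rw [mul_div_cancel₀]
      exact_mod_cast hs.ne'

theorem nonneg_of_mem_concSet {S T : Type*} [Fintype S] [Fintype T]
    {ρ : Matrix (S × T) (S × T) ℂ} {c : ℝ} (hc : c ∈ concSet ρ) : 0 ≤ c := by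
  obtain ⟨n, p, φ, hp, -, -, -, rfl⟩ := hc
  exact Finset.sum_nonneg fun i _ => mul_nonneg (hp i) (Real.sqrt_nonneg _)

theorem conc_nonneg {S T : Type*} [Fintype S] [Fintype T] (ρ : Matrix (S × T) (S × T) ℂ) :
    0 ≤ conc ρ :=
  Real.sInf_nonneg fun _ => nonneg_of_mem_concSet

theorem HasConcBound.conc_le {ρ : Matrix (Fin 2 × Fin 2) (Fin 2 × Fin 2) ℂ} {c : ℝ}
    (h : HasConcBound ρ c) (htr : ρ.trace = 1) : conc ρ ≤ c := by
  obtain ⟨κ, _, F, rfl, hF⟩ := h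
  refine (csInf_le ⟨0, fun _ => nonneg_of_mem_concSet⟩ ?_).trans hF
  choose φ hφ hFφ using fun k => exists_normalized fun x => F x k
  set p : κ → ℝ := fun k => ∑ x, ‖F x k‖ ^ 2
  have hp : ∀ k, 0 ≤ p k := fun k => Finset.sum_nonneg fun _ _ => sq_nonneg _
  have hpp : ∀ k, ((√(p k) : ℝ) : ℂ) * ((√(p k) : ℝ) : ℂ) = p k := fun k => by
    rw [← Complex.ofReal_mul, Real.mul_self_sqrt (hp k)]
  let e := (Fintype.equivFin κ).symm
  refine ⟨Fintype.card κ, fun i => p (e i), fun i => φ (e i), fun i => hp _, ?_, fun i => hφ _, ?_,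
    ?_⟩
  · rw [e.sum_comp p]
    rw [trace_mul_conjTranspose_eq_sum] at htr
    rw [← Complex.ofReal_inj, Complex.ofReal_one, ← htr, Finset.sum_comm]
  · rw [e.sum_comp fun k => (p k : ℂ) • pureDM (φ k)]
    ext x y
    rw [Matrix.mul_apply, Matrix.sum_apply]
    refine Finset.sum_congr rfl fun k _ => ?_
    rw [conjTranspose_apply, hFφ k x, hFφ k y, Matrix.smul_apply, smul_eq_mul, pureDM, ← hpp,
      Complex.star_def, map_mul, Complex.conj_ofReal]
    ring
  · rw [e.sum_comp fun k => p k * pureConc (φ k)]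
    refine Finset.sum_congr rfl fun k _ => ?_
    have : colMat F k = ((√(p k) : ℝ) : ℂ) • of fun a c => φ k (a, c) := by
      ext a c
      exact hFφ k (a, c)
    rw [pureConc_eq (hφ k), this, det_smul, Fintype.card_fin, norm_mul, sq, hpp, Complex.norm_real,
      Real.norm_of_nonneg (hp k)]
    ring

theorem sqrt_add_sqrt_sq_le {t₀ t₁ h₀ h₁ k : ℝ} (ht₀ : 0 ≤ t₀) (ht₁ : 0 ≤ t₁)
    (hh₀ : 0 ≤ h₀) (hh₁ : 0 ≤ h₁) (hle₀ : h₀ ≤ t₀ ^ 2) (hle₁ : h₁ ≤ t₁ ^ 2)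
    (hk : k ^ 2 ≤ h₀ * h₁) (ht : t₀ + t₁ = 1) :
    (√(2 * (t₀ ^ 2 - h₀)) + √(2 * (t₁ ^ 2 - h₁))) ^ 2 ≤ 2 * (1 - (h₀ + 2 * k + h₁)) := by
  have e₀ := Real.sq_sqrt hh₀
  have e₁ := Real.sq_sqrt hh₁
  set a := √h₀
  set b := √h₁
  have ha : 0 ≤ a := Real.sqrt_nonneg _
  have hb : 0 ≤ b := Real.sqrt_nonneg _
  have hat : a ≤ t₀ := abs_le_of_sq_le_sq (by rw [e₀]; exact hle₀) ht₀ |> (abs_le.mp · |>.2)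
  have hbt : b ≤ t₁ := abs_le_of_sq_le_sq (by rw [e₁]; exact hle₁) ht₁ |> (abs_le.mp · |>.2)
  have hkab : k ≤ a * b :=
    abs_le_of_sq_le_sq (by rw [mul_pow, e₀, e₁]; exact hk) (by positivity) |> (abs_le.mp · |>.2)
  have f₀ := Real.sq_sqrt (show 0 ≤ 2 * (t₀ ^ 2 - h₀) by linarith)
  have f₁ := Real.sq_sqrt (show 0 ≤ 2 * (t₁ ^ 2 - h₁) by linarith)
  set u := √(2 * (t₀ ^ 2 - h₀))
  set v := √(2 * (t₁ ^ 2 - h₁))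
  have huv : u * v ≤ 2 * (t₀ * t₁ - a * b) := by
    have hab : a * b ≤ t₀ * t₁ := mul_le_mul hat hbt hb ht₀
    refine abs_le_of_sq_le_sq ?_ (by linarith) |> (abs_le.mp · |>.2)
    rw [mul_pow, f₀, f₁, ← e₀, ← e₁]
    nlinarith [sq_nonneg (t₀ * b - t₁ * a)]
  nlinarith

theorem trace_sum_pairRed {m : ℕ} (j : Fin m) (χ : Fin 2 → Matrix (Fin 2) (Fin m → Fin 2) ℂ)
    (hχ : ∑ b, ∑ a, ∑ f, ‖χ b a f‖ ^ 2 = 1) : (∑ b, pairRed j (χ b)).trace = 1 := by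
  have h : ∀ φ : Matrix (Fin 2) (Fin m → Fin 2) ℂ,
      (pairRed j φ).trace = ((∑ a, ∑ f, ‖φ a f‖ ^ 2 : ℝ) : ℂ) := by
    intro φ
    rw [trace, Fintype.sum_prod_type]
    push_cast
    refine Finset.sum_congr rfl fun a _ => ?_
    simp only [diag_apply, pairRed]
    rw [Finset.sum_comm]
    refine Finset.sum_congr rfl fun f _ => ?_
    rw [Finset.sum_ite_eq, if_pos (Finset.mem_univ _), Function.update_eq_self, Complex.star_def,
      Complex.mul_conj, Complex.normSq_eq_norm_sq]
    norm_cast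
  rw [trace_sum]
  simp only [h]
  rw [← Complex.ofReal_sum, hχ, Complex.ofReal_one]

theorem sum_conc_sq_le {m : ℕ} (χ : Fin 2 → Matrix (Fin 2) (Fin m → Fin 2) ℂ)
    (hχ : ∑ b, ∑ a, ∑ f, ‖χ b a f‖ ^ 2 = 1) :
    ∑ j, conc (∑ b, pairRed j (χ b)) ^ 2 ≤
      2 * (1 - ∑ b, ∑ b', ∑ a, ∑ a', ‖(χ b * (χ b')ᴴ) a a'‖ ^ 2) := by
  obtain ⟨u, hu, hbu, hu'⟩ := exists_monogamy_bound (χ 0)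
  obtain ⟨v, hv, hbv, hv'⟩ := exists_monogamy_bound (χ 1)
  have hconc : ∀ j, conc (∑ b, pairRed j (χ b)) ^ 2 ≤ (u j + v j) ^ 2 := by
    intro j
    have htr := trace_sum_pairRed j χ hχ
    have hb : HasConcBound (∑ b, pairRed j (χ b)) (u j + v j) := by
      rw [Fin.sum_univ_two]
      exact (hbu j).add (hbv j)
    exact pow_le_pow_left₀ (conc_nonneg _) (hb.conc_le htr) 2
  refine (Finset.sum_le_sum fun j _ => hconc j).trans ?_
  have hd₀ := det_mul_conjTranspose_nonneg (χ 0)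
  have hd₁ := det_mul_conjTranspose_nonneg (χ 1)
  rw [four_mul_det_mul_conjTranspose] at hu' hv'
  have hd₀' := four_mul_det_mul_conjTranspose (χ 0)
  have hd₁' := four_mul_det_mul_conjTranspose (χ 1)
  have hcross : ∑ a, ∑ a', ‖(χ 1 * (χ 0)ᴴ) a a'‖ ^ 2 = ∑ a, ∑ a', ‖(χ 0 * (χ 1)ᴴ) a a'‖ ^ 2 := by
    rw [sum_norm_sq_mul_conjTranspose, sum_norm_sq_mul_conjTranspose, trace_mul_comm]
  have hself : ∀ X : Matrix (Fin 2) (Fin m → Fin 2) ℂ,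
      ∑ f, ∑ g, ‖(Xᴴ * X) f g‖ ^ 2 = ∑ a, ∑ a', ‖(X * Xᴴ) a a'‖ ^ 2 := by
    intro X
    have h1 := sum_norm_sq_mul_conjTranspose Xᴴ Xᴴ
    have h2 := sum_norm_sq_mul_conjTranspose X X
    rw [conjTranspose_conjTranspose] at h1
    rw [h1, h2, Matrix.mul_assoc, trace_mul_comm]
    simp only [Matrix.mul_assoc]
  have hk := trace_re_sq_le ((χ 0)ᴴ * χ 0) ((χ 1)ᴴ * χ 1)
  rw [← sum_norm_sq_mul_conjTranspose, hself, hself] at hk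
  have hsum : ∀ G : Fin 2 → Fin 2 → ℝ,
      ∑ b, ∑ b', G b b' = G 0 0 + G 0 1 + (G 1 0 + G 1 1) := by
    intro G
    simp only [Fin.sum_univ_two]
  rw [hsum fun b b' => ∑ a, ∑ a', ‖(χ b * (χ b')ᴴ) a a'‖ ^ 2, hcross]
  rw [Fin.sum_univ_two] at hχ
  have hnn : ∀ {r s : Type} [Fintype r] [Fintype s] (X : Matrix r s ℂ),
      0 ≤ ∑ i, ∑ j, ‖X i j‖ ^ 2 := fun X =>
    Finset.sum_nonneg fun _ _ => Finset.sum_nonneg fun _ _ => sq_nonneg _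
  have n₀ := hnn (χ 0)
  have n₁ := hnn (χ 1)
  have n₀₀ := hnn (χ 0 * (χ 0)ᴴ)
  have n₁₁ := hnn (χ 1 * (χ 1)ᴴ)
  generalize (∑ a, ∑ f, ‖χ 0 a f‖ ^ 2) = t₀ at *
  generalize (∑ a, ∑ f, ‖χ 1 a f‖ ^ 2) = t₁ at *
  generalize (∑ a, ∑ a', ‖(χ 0 * (χ 0)ᴴ) a a'‖ ^ 2) = h₀ at *
  generalize (∑ a, ∑ a', ‖(χ 1 * (χ 1)ᴴ) a a'‖ ^ 2) = h₁ at *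
  generalize (∑ a, ∑ a', ‖(χ 0 * (χ 1)ᴴ) a a'‖ ^ 2) = k at *
  have l₀ : h₀ ≤ t₀ ^ 2 := by linarith
  have l₁ : h₁ ≤ t₁ ^ 2 := by linarith
  refine (sum_add_sq_le_add_sq (Real.sqrt_nonneg _) (Real.sqrt_nonneg _)
    (hu'.trans_eq (Real.sq_sqrt (by linarith)).symm)
    (hv'.trans_eq (Real.sq_sqrt (by linarith)).symm)).trans ?_
  refine (sqrt_add_sqrt_sq_le n₀ n₁ n₀₀ n₁₁ l₀ l₁ hk hχ).trans_eq ?_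
  ring

theorem pureConc_sq_eq {S T : Type*} [Fintype S] [Fintype T] (ψ : S × T → ℂ) :
    pureConc ψ ^ 2 = max 0 (2 * (1 - ∑ s, ∑ s', ‖∑ t, ψ (s, t) * star (ψ (s', t))‖ ^ 2)) := by
  have h : trSq (ptraceRight (pureDM ψ)) = ∑ s, ∑ s', ‖∑ t, ψ (s, t) * star (ψ (s', t))‖ ^ 2 := by
    have hH : (ptraceRight (pureDM ψ))ᴴ = ptraceRight (pureDM ψ) := by
      ext s s'
      simp [ptraceRight, pureDM, mul_comm]
    have h1 := trace_mul_conjTranspose_eq_sum (ptraceRight (pureDM ψ))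
    rw [hH] at h1
    rw [trSq, h1, Complex.ofReal_re]
    rfl
  rw [pureConc, h]
  rcases le_total 0 (2 * (1 - ∑ s, ∑ s', ‖∑ t, ψ (s, t) * star (ψ (s', t))‖ ^ 2)) with h0 | h0
  · rw [Real.sq_sqrt h0, max_eq_right h0]
  · rw [Real.sqrt_eq_zero_of_nonpos h0, max_eq_left h0]
    norm_num

theorem le_qubitCut_sq {m : ℕ} (ψ : (Fin (m + 2) → Fin 2) → ℂ) :
    2 * (1 - ∑ s : Fin 2 × Fin 2, ∑ s' : Fin 2 × Fin 2, ‖∑ f : Fin m → Fin 2,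
      ψ (Fin.cons s.1 (Fin.cons s.2 f)) * star (ψ (Fin.cons s'.1 (Fin.cons s'.2 f)))‖ ^ 2) ≤
    qubitCut (fun i : Fin (m + 2) => (i : ℕ) < 2) ψ ^ 2 := by
  let eS : Fin 2 ≃ {i : Fin (m + 2) // (i : ℕ) < 2} :=
    { toFun := fun i => ⟨⟨i, by omega⟩, i.isLt⟩
      invFun := fun x => ⟨x.1, x.2⟩
      left_inv := fun _ => rfl
      right_inv := fun _ => rfl }
  let eT : Fin m ≃ {i : Fin (m + 2) // ¬ (i : ℕ) < 2} :=
    { toFun := fun i => ⟨i.succ.succ, by simp⟩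
      invFun := fun x => ⟨(x.1 : ℕ) - 2, by have := x.1.isLt; have := x.2; omega⟩
      left_inv := fun _ => rfl
      right_inv := fun x => by
        have := x.2
        ext
        simp
        omega }
  let e₁ : Fin 2 × Fin 2 ≃ ({i : Fin (m + 2) // (i : ℕ) < 2} → Fin 2) :=
    (finTwoArrowEquiv (Fin 2)).symm.trans (eS.arrowCongr (Equiv.refl _))
  let e₂ : (Fin m → Fin 2) ≃ ({i : Fin (m + 2) // ¬ (i : ℕ) < 2} → Fin 2) :=
    eT.arrowCongr (Equiv.refl _)
  have key : ∀ s f, (Equiv.piEquivPiSubtypeProd (fun i : Fin (m + 2) => (i : ℕ) < 2)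
      (fun _ => Fin 2)).symm (e₁ s, e₂ f) = Fin.cons s.1 (Fin.cons s.2 f) := by
    intro s f
    rw [Equiv.symm_apply_eq]
    refine Prod.ext (funext fun x => ?_) (funext fun x => ?_)
    · obtain ⟨i, rfl⟩ := eS.surjective x
      fin_cases i <;> rfl
    · obtain ⟨i, rfl⟩ := eT.surjective x
      show f (eT.symm (eT i)) = _
      rw [Equiv.symm_apply_apply]
      rfl
  rw [qubitCut, pureConc_sq_eq]
  refine le_max_of_le_right (le_of_eq ?_)
  congr 2
  rw [← e₁.sum_comp]
  refine Finset.sum_congr rfl fun s _ => ?_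
  rw [← e₁.sum_comp]
  refine Finset.sum_congr rfl fun s' _ => ?_
  rw [← e₂.sum_comp]
  simp only [key]

theorem assemble2_restrict {N : ℕ} {u v : Fin N} (huv : v ≠ u) (x y : Fin 2)
    (g : Fin N → Fin 2) :
    assemble2 u v x y (fun i => g i.1) = Function.update (Function.update g u x) v y := by
  funext i
  by_cases hv : i = v
  · subst hv
    simp [assemble2, huv]
  · by_cases hu : i = u
    · subst hu
      simp [assemble2, hv]
    · simp [assemble2, hu, hv]

theorem rdm2_apply {N : ℕ} {u v : Fin N} (huv : v ≠ u) (ψ : (Fin N → Fin 2) → ℂ)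
    (x y : Fin 2 × Fin 2) :
    rdm2 u v ψ x y = ∑ g : Fin N → Fin 2, if g u = x.1 ∧ g v = x.2 then
      ψ g * star (ψ (Function.update (Function.update g u y.1) v y.2)) else 0 := by
  rw [← Finset.sum_filter, rdm2]
  have hr : ∀ (a b : Fin 2) (f : {i : Fin N // i ≠ u ∧ i ≠ v} → Fin 2),
      (fun i : {i : Fin N // i ≠ u ∧ i ≠ v} => assemble2 u v a b f i.1) = f := by
    intro a b f
    funext i
    simp [assemble2, i.2.1, i.2.2]
  refine Finset.sum_bij' (fun f _ => assemble2 u v x.1 x.2 f) (fun g _ i => g i.1) ?_ ?_ ?_ ?_ ?_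
  · intro f _
    simp [assemble2, huv]
  · intro g _
    exact Finset.mem_univ _
  · intro f _
    exact hr _ _ f
  · intro g hg
    obtain ⟨h1, h2⟩ := (Finset.mem_filter.mp hg).2
    rw [assemble2_restrict huv, ← h1, ← h2, Function.update_eq_self, Function.update_eq_self]
  · intro f _
    rw [← assemble2_restrict huv, hr]
    rfl

theorem rdm2_zero {m : ℕ} (j : Fin m) (ψ : (Fin (m + 2) → Fin 2) → ℂ) :
    rdm2 0 j.succ.succ ψ =
      ∑ b, pairRed j (of fun a f => ψ (Fin.cons a (Fin.cons b f))) := by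
  ext x y
  rw [rdm2_apply (Fin.succ_ne_zero _), sum_fin_succ_arrow, Matrix.sum_apply]
  simp only [sum_fin_succ_arrow, Fin.cons_zero, Fin.cons_succ, Fin.update_cons_zero,
    ← Fin.cons_update, pairRed, of_apply, ite_and]
  rw [Finset.sum_comm]
  refine Finset.sum_congr rfl fun b _ => ?_
  rw [Finset.sum_comm]
  simp

theorem rdm2_one {m : ℕ} (j : Fin m) (ψ : (Fin (m + 2) → Fin 2) → ℂ) :
    rdm2 (Fin.succ 0) j.succ.succ ψ =
      ∑ b, pairRed j (of fun a f => ψ (Fin.cons b (Fin.cons a f))) := by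
  ext x y
  rw [rdm2_apply (Fin.succ_injective _ |>.ne (Fin.succ_ne_zero j)), sum_fin_succ_arrow, Matrix.sum_apply]
  simp only [sum_fin_succ_arrow, Fin.cons_zero, Fin.cons_succ, Fin.update_cons_zero,
    ← Fin.cons_update, pairRed, of_apply, ite_and]
  refine Finset.sum_congr rfl fun b _ => ?_
  rw [Finset.sum_comm]
  simp

theorem sum_conc_zero_sq_le {m : ℕ} (ψ : (Fin (m + 2) → Fin 2) → ℂ) (hψ : ∑ x, ‖ψ x‖ ^ 2 = 1) :
    ∑ j : Fin m, conc (rdm2 0 j.succ.succ ψ) ^ 2 ≤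
      qubitCut (fun i : Fin (m + 2) => (i : ℕ) < 2) ψ ^ 2 := by
  simp only [rdm2_zero]
  refine (sum_conc_sq_le (fun b => of fun a f => ψ (Fin.cons a (Fin.cons b f))) ?_).trans
    (le_trans (le_of_eq ?_) (le_qubitCut_sq ψ))
  · rw [← hψ, sum_fin_succ_arrow, Finset.sum_comm]
    simp only [sum_fin_succ_arrow, of_apply]
  · simp only [Fintype.sum_prod_type, Fin.sum_univ_two (M := ℝ), Matrix.mul_apply,
      conjTranspose_apply, of_apply]
    ring

theorem sum_conc_one_sq_le {m : ℕ} (ψ : (Fin (m + 2) → Fin 2) → ℂ) (hψ : ∑ x, ‖ψ x‖ ^ 2 = 1) :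
    ∑ j : Fin m, conc (rdm2 (Fin.succ 0) j.succ.succ ψ) ^ 2 ≤
      qubitCut (fun i : Fin (m + 2) => (i : ℕ) < 2) ψ ^ 2 := by
  simp only [rdm2_one]
  refine (sum_conc_sq_le (fun b => of fun a f => ψ (Fin.cons b (Fin.cons a f))) ?_).trans
    (le_trans (le_of_eq ?_) (le_qubitCut_sq ψ))
  · rw [← hψ, sum_fin_succ_arrow]
    simp only [sum_fin_succ_arrow, of_apply]
  · simp only [Fintype.sum_prod_type, Fin.sum_univ_two (M := ℝ), Matrix.mul_apply,
      conjTranspose_apply, of_apply]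
    ring

/-- Theorem 1 of the paper: generalized monogamy lower bound for the
concurrence of an `N`-qubit pure state across the cut `AB | C₁…C_{N-2}`.
Qubits: `A = 0`, `B = 1`, `C_i = i + 1` (so `C_i` is qubit `i + 2` when the
`C`'s are indexed by `i : Fin (N - 2)` starting from `0`). -/
theorem theorem1_generalized_monogamy_lower
    (N : ℕ) (hN : 3 ≤ N) (ψ : (Fin N → Fin 2) → ℂ)
    (hψ : ∑ x, ‖ψ x‖ ^ 2 = 1) :
    (qubitCut (fun i : Fin N => (i : ℕ) < 2) ψ) ^ 2 ≥
      max
        (∑ i : Fin (N - 2),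
          ((conc (rdm2 (⟨0, by omega⟩ : Fin N) (⟨(i : ℕ) + 2, by have := i.isLt; omega⟩ : Fin N) ψ)) ^ 2 -
            (concA (rdm2 (⟨1, by omega⟩ : Fin N) (⟨(i : ℕ) + 2, by have := i.isLt; omega⟩ : Fin N) ψ)) ^ 2))
        (∑ i : Fin (N - 2),
          ((conc (rdm2 (⟨1, by omega⟩ : Fin N) (⟨(i : ℕ) + 2, by have := i.isLt; omega⟩ : Fin N) ψ)) ^ 2 -
            (concA (rdm2 (⟨0, by omega⟩ : Fin N) (⟨(i : ℕ) + 2, by have := i.isLt; omega⟩ : Fin N) ψ)) ^ 2)) := by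
  obtain ⟨m, rfl⟩ : ∃ m, N = m + 2 := ⟨N - 2, by omega⟩
  refine max_le ((Finset.sum_le_sum fun i _ => sub_le_self _ (sq_nonneg _)).trans ?_)
    ((Finset.sum_le_sum fun i _ => sub_le_self _ (sq_nonneg _)).trans ?_)
  · exact sum_conc_zero_sq_le ψ hψ
  · exact sum_conc_one_sq_le ψ hψ

end
end

section
/- Theorem 2: Let N ≥ 3 and let |ψ⟩ be an N-qubit pure state on qubits A, B, C₁, …, C_{N−2}. Then C²(|ψ⟩_{AB|C₁…C_{N−2}}) ≤ 2·C_a²(ρ_{AB}) + Σ_{i=1}^{N−2} ( C_a²(ρ_{AC_i}) + C_a²(ρ_{BC_i}) ), where ρ_{AB}, ρ_{AC_i}, ρ_{BC_i} are the two-qubit reduced density matrices of |ψ⟩⟨ψ|. -/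
open scoped BigOperators

noncomputable section

open Module in
/-- A conjugate-linear map on a nontrivial finite-dimensional complex inner product space that is
symmetric in the sense `⟪v, T w⟫ = ⟪w, T v⟫` has a unit eigenvector with real eigenvalue. -/
theorem exists_unit_eigenvector_of_antilinear {E : Type*} [NormedAddCommGroup E]
    [InnerProductSpace ℂ E] [FiniteDimensional ℂ E] [Nontrivial E] (T : E →ₛₗ[starRingEnd ℂ] E)
    (hT : ∀ v w, inner ℂ v (T w) = inner ℂ w (T v)) :
    ∃ (v : E) (r : ℝ), ‖v‖ = 1 ∧ T v = (r : ℂ) • v := by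
  suffices h : ∃ (v : E) (r : ℝ), v ≠ 0 ∧ T v = (r : ℂ) • v by
    obtain ⟨v, r, hv, h⟩ := h
    have hv' : (‖v‖ : ℂ) ≠ 0 := by simpa using hv
    refine ⟨((‖v‖⁻¹ : ℝ) : ℂ) • v, r, ?_, ?_⟩
    · rw [norm_smul]
      simp [hv]
    · rw [map_smulₛₗ, h, Complex.conj_ofReal, smul_comm]
  obtain ⟨μ, hμ⟩ := End.exists_eigenvalue (T.comp T : End ℂ E)
  obtain ⟨u, hu⟩ := hμ.exists_hasEigenvector
  have hu0 : u ≠ 0 := hu.2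
  have hTT : T (T u) = μ • u := hu.apply_eq_smul
  have hn : (‖u‖ : ℂ) ≠ 0 := by simpa using hu0
  obtain ⟨s, hs⟩ : ∃ s : ℝ, μ = (s : ℂ) * s := by
    refine ⟨‖T u‖ / ‖u‖, ?_⟩
    have h := hT u (T u)
    rw [hTT, inner_smul_right, inner_self_eq_norm_sq_to_K, inner_self_eq_norm_sq_to_K] at h
    push_cast
    field_simp
    exact h
  by_cases hv : T u + (s : ℂ) • u = 0
  · refine ⟨u, -s, hu0, ?_⟩
    rw [eq_neg_of_add_eq_zero_left hv]
    simp
  · refine ⟨T u + (s : ℂ) • u, s, hv, ?_⟩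
    rw [map_add, map_smulₛₗ, Complex.conj_ofReal, hTT, hs, smul_add, smul_smul, add_comm]

open Module in
/-- **Takagi factorization**: a symmetric conjugate-linear map is diagonal with real eigenvalues in
some orthonormal basis. -/
theorem exists_orthonormalBasis_antilinear_eigenvectors {E : Type*} [NormedAddCommGroup E]
    [InnerProductSpace ℂ E] [FiniteDimensional ℂ E] (T : E →ₛₗ[starRingEnd ℂ] E)
    (hT : ∀ v w, inner ℂ v (T w) = inner ℂ w (T v)) :
    ∃ (b : OrthonormalBasis (Fin (finrank ℂ E)) ℂ E) (r : Fin (finrank ℂ E) → ℝ),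
      ∀ i, T (b i) = (r i : ℂ) • b i := by
  have key : ∀ k ≤ finrank ℂ E, ∃ v : Fin k → E, Orthonormal ℂ v ∧
      ∀ i, ∃ r : ℝ, T (v i) = (r : ℂ) • v i := by
    intro k
    induction k with
    | zero => exact fun _ => ⟨Fin.elim0, ⟨fun i => i.elim0, fun i => i.elim0⟩, fun i => i.elim0⟩
    | succ k ih =>
      intro hk
      obtain ⟨v, hv, hvT⟩ := ih (by omega)
      set K : Submodule ℂ E := (Submodule.span ℂ (Set.range v))ᗮ with hK
      have mem_K : ∀ x, x ∈ K ↔ ∀ i, inner ℂ (v i) x = 0 := by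
        intro x
        rw [hK, Submodule.mem_orthogonal]
        refine ⟨fun h i => h _ (Submodule.subset_span ⟨i, rfl⟩), fun h y hy => ?_⟩
        induction hy using Submodule.span_induction with
        | mem y hy => obtain ⟨i, rfl⟩ := hy; exact h i
        | zero => simp
        | add y z _ _ hy hz => rw [inner_add_left, hy, hz, add_zero]
        | smul a y _ hy => rw [inner_smul_left, hy, mul_zero]
      have hTK : ∀ x ∈ K, T x ∈ K := by
        intro x hx
        rw [mem_K] at hx ⊢
        intro i
        obtain ⟨r, hr⟩ := hvT i
        rw [hT, hr, inner_smul_right, ← inner_conj_symm, hx i]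
        simp
      have hrank : finrank ℂ (Submodule.span ℂ (Set.range v)) = k := by
        simpa using finrank_span_eq_card hv.linearIndependent
      have hKpos : 0 < finrank ℂ K := by
        have h := Submodule.finrank_add_finrank_orthogonal (Submodule.span ℂ (Set.range v))
        rw [hrank, ← hK] at h
        omega
      have : Nontrivial K := finrank_pos_iff.mp hKpos
      obtain ⟨w, r, hw, hwT⟩ := exists_unit_eigenvector_of_antilinear
        ((T.domRestrict K).codRestrict K fun x => hTK x x.2) fun x y => hT x y
      refine ⟨Matrix.vecCons (w : E) v, ?_, ?_⟩
      · refine orthonormal_vecCons_iff.mpr ⟨hw, fun i => ?_, hv⟩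
        rw [← inner_conj_symm, (mem_K w).mp w.2 i, map_zero]
      · refine Fin.cases ⟨r, ?_⟩ hvT
        exact congrArg Subtype.val hwT
  obtain ⟨v, hv, hvT⟩ := key _ le_rfl
  choose r hr using hvT
  obtain ⟨b, hb⟩ := Orthonormal.exists_orthonormalBasis_extension_of_card_eq
    (𝕜 := ℂ) (E := E) (ι := Fin (finrank ℂ E)) (by simp) (v := v) (s := Set.univ)
    (hv.comp _ Subtype.val_injective)
  exact ⟨b, r, fun i => by rw [hb i trivial, hr]⟩

/-- The Hilbert–Schmidt norm of a symmetric conjugate-linear map can be computed in any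
orthonormal basis. -/
theorem sum_norm_sq_antilinear_eq {E : Type*} [NormedAddCommGroup E] [InnerProductSpace ℂ E]
    {ι κ : Type*} [Fintype ι] [Fintype κ] (T : E →ₛₗ[starRingEnd ℂ] E)
    (hT : ∀ v w, inner ℂ v (T w) = inner ℂ w (T v))
    (b : OrthonormalBasis ι ℂ E) (e : OrthonormalBasis κ ℂ E) :
    ∑ i, ‖T (b i)‖ ^ 2 = ∑ j, ‖T (e j)‖ ^ 2 := by
  simp_rw [← e.sum_sq_norm_inner_right (T (b _)), ← b.sum_sq_norm_inner_right (T (e _))]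
  rw [Finset.sum_comm]
  simp_rw [hT]

/-- Takagi factorization of a complex symmetric kernel `R`, in coordinates. -/
theorem exists_takagi {ι : Type*} [Fintype ι] [DecidableEq ι] (R : ι → ι → ℂ)
    (hR : ∀ i j, R i j = R j i) :
    ∃ (n : ℕ) (b : Fin n → ι → ℂ),
      (∀ i j, ∑ k, b k i * starRingEnd ℂ (b k j) = if i = j then 1 else 0) ∧
      ∑ i, ∑ j, ‖R i j‖ ^ 2 = ∑ k, ‖∑ i, ∑ j, b k i * b k j * R i j‖ ^ 2 := by
  let T : EuclideanSpace ℂ ι →ₛₗ[starRingEnd ℂ] EuclideanSpace ℂ ι :=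
    { toFun := fun v => WithLp.toLp 2 fun i => starRingEnd ℂ (∑ j, R i j * v j)
      map_add' := fun v w => by
        ext i
        simp [mul_add, Finset.sum_add_distrib]
      map_smul' := fun a v => by
        ext i
        simp [Finset.mul_sum, mul_left_comm] }
  have inner_T : ∀ v w, inner ℂ v (T w) = starRingEnd ℂ (∑ i, ∑ j, v i * w j * R i j) := by
    intro v w
    simp only [PiLp.inner_apply, T, RCLike.inner_apply, LinearMap.coe_mk, AddHom.coe_mk, map_sum,
      map_mul, Finset.sum_mul]
    refine Finset.sum_congr rfl fun i _ => Finset.sum_congr rfl fun j _ => by ring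
  have hT : ∀ v w, inner ℂ v (T w) = inner ℂ w (T v) := by
    intro v w
    rw [inner_T, inner_T, Finset.sum_comm]
    simp_rw [hR, mul_comm (v _)]
  obtain ⟨b, r, hb⟩ := exists_orthonormalBasis_antilinear_eigenvectors T hT
  refine ⟨_, fun k i => b k i, fun i j => ?_, ?_⟩
  · have h := b.sum_inner_mul_inner (EuclideanSpace.single i 1) (EuclideanSpace.single j 1)
    simpa [EuclideanSpace.inner_single_left, EuclideanSpace.inner_single_right, eq_comm] using h
  · have h := sum_norm_sq_antilinear_eq T hT b (EuclideanSpace.basisFun ι ℂ)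
    have h1 : ∀ k, ‖∑ i, ∑ j, b k i * b k j * R i j‖ = ‖T (b k)‖ := by
      intro k
      rw [← Complex.norm_conj, ← inner_T, hb, inner_smul_right, norm_smul]
      simp [b.orthonormal.1 k, inner_self_eq_norm_sq_to_K]
    simp_rw [h1, h, EuclideanSpace.norm_sq_eq]
    rw [Finset.sum_comm]
    simp [T]

/-- The bilinear form `⟨x* | σ_y ⊗ σ_y | y⟩` (up to sign) whose diagonal is the concurrence. -/
def spinFlipForm (x y : Fin 2 × Fin 2 → ℂ) : ℂ :=
  x (0, 0) * y (1, 1) - x (0, 1) * y (1, 0) - x (1, 0) * y (0, 1) + x (1, 1) * y (0, 0)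

theorem spinFlipForm_comm (x y : Fin 2 × Fin 2 → ℂ) : spinFlipForm x y = spinFlipForm y x := by
  unfold spinFlipForm
  ring

theorem spinFlipForm_smul (a : ℂ) (x : Fin 2 × Fin 2 → ℂ) :
    spinFlipForm (a • x) (a • x) = a ^ 2 * spinFlipForm x x := by
  simp only [spinFlipForm, Pi.smul_apply, smul_eq_mul]
  ring

theorem spinFlipForm_sum {ι : Type*} [Fintype ι] (b : ι → ℂ) (φ : ι → Fin 2 × Fin 2 → ℂ) :
    spinFlipForm (∑ i, b i • φ i) (∑ i, b i • φ i) =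
      ∑ i, ∑ j, b i * b j * spinFlipForm (φ i) (φ j) := by
  simp only [spinFlipForm, Finset.sum_apply, Pi.smul_apply, smul_eq_mul, Finset.sum_mul_sum,
    ← Finset.sum_sub_distrib, ← Finset.sum_add_distrib]
  refine Finset.sum_congr rfl fun i _ => Finset.sum_congr rfl fun j _ => by ring

theorem norm_sq_spinFlipForm_self (x : Fin 2 × Fin 2 → ℂ) :
    ‖spinFlipForm x x‖ ^ 2 = 2 * ((∑ i, ‖x i‖ ^ 2) ^ 2 - trSq (ptraceRight (pureDM x))) := by
  simp only [spinFlipForm, trSq, ptraceRight, pureDM, Matrix.trace, Matrix.diag, Matrix.mul_apply,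
    Fintype.sum_prod_type, Fin.sum_univ_two, Complex.sq_norm, Complex.normSq_apply, Complex.add_re,
    Complex.add_im, Complex.sub_re, Complex.sub_im, Complex.mul_re, Complex.mul_im,
    Complex.conj_re, Complex.conj_im]
  ring

theorem pureConc_eq_norm_spinFlipForm (x : Fin 2 × Fin 2 → ℂ) (hx : ∑ i, ‖x i‖ ^ 2 = 1) :
    pureConc x = ‖spinFlipForm x x‖ := by
  have h := norm_sq_spinFlipForm_self x
  rw [hx, one_pow] at h
  rw [pureConc, ← h, Real.sqrt_sq (norm_nonneg _)]

theorem norm_spinFlipForm_self_le (x : Fin 2 × Fin 2 → ℂ) :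
    ‖spinFlipForm x x‖ ≤ ∑ i, ‖x i‖ ^ 2 := by
  have h : spinFlipForm x x = 2 * (x (0, 0) * x (1, 1)) - 2 * (x (0, 1) * x (1, 0)) := by
    unfold spinFlipForm
    ring
  have h' := norm_sub_le (2 * (x (0, 0) * x (1, 1))) (2 * (x (0, 1) * x (1, 0)))
  simp only [norm_mul, Complex.norm_ofNat] at h'
  rw [h]
  simp only [Fintype.sum_prod_type, Fin.sum_univ_two]
  nlinarith [sq_nonneg (‖x (0, 0)‖ - ‖x (1, 1)‖), sq_nonneg (‖x (0, 1)‖ - ‖x (1, 0)‖)]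

theorem bddAbove_concSet (ρ : Matrix (Fin 2 × Fin 2) (Fin 2 × Fin 2) ℂ) :
    BddAbove (concSet ρ) := by
  refine ⟨1, ?_⟩
  rintro c ⟨n, p, φ, hp, hp1, hφ, -, rfl⟩
  rw [← hp1]
  refine Finset.sum_le_sum fun i _ => mul_le_of_le_one_right (hp i) ?_
  rw [pureConc_eq_norm_spinFlipForm _ (hφ i), ← hφ i]
  exact norm_spinFlipForm_self_le _

theorem exists_normalized_s1 (x : Fin 2 × Fin 2 → ℂ) :
    ∃ y : Fin 2 × Fin 2 → ℂ, ∑ i, ‖y i‖ ^ 2 = 1 ∧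
      pureDM x = ((∑ i, ‖x i‖ ^ 2 : ℝ) : ℂ) • pureDM y ∧
      ‖spinFlipForm x x‖ = (∑ i, ‖x i‖ ^ 2) * pureConc y := by
  suffices h : ∃ y : Fin 2 × Fin 2 → ℂ, ∑ i, ‖y i‖ ^ 2 = 1 ∧
      x = ((√(∑ i, ‖x i‖ ^ 2) : ℝ) : ℂ) • y by
    obtain ⟨y, hy, hxy⟩ := h
    have hs : 0 ≤ ∑ i, ‖x i‖ ^ 2 := by positivity
    set s := ∑ i, ‖x i‖ ^ 2
    refine ⟨y, hy, ?_, ?_⟩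
    · rw [hxy]
      ext i j
      simp only [pureDM, Pi.smul_apply, Matrix.smul_apply, smul_eq_mul, map_mul, Complex.conj_ofReal]
      rw [mul_mul_mul_comm, ← Complex.ofReal_mul, Real.mul_self_sqrt hs]
    · rw [hxy, spinFlipForm_smul, norm_mul, pureConc_eq_norm_spinFlipForm y hy,
        ← Complex.ofReal_pow, Real.sq_sqrt hs, Complex.norm_real, Real.norm_of_nonneg hs]
  by_cases hx : ∑ i, ‖x i‖ ^ 2 = 0
  · refine ⟨Pi.single (0, 0) 1, ?_, ?_⟩
    · simp [Pi.single_apply, Fintype.sum_prod_type]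
    · rw [hx]
      ext i
      rw [Finset.sum_eq_zero_iff_of_nonneg fun i _ => by positivity] at hx
      simpa using hx i
  · have hs : 0 ≤ ∑ i, ‖x i‖ ^ 2 := by positivity
    have hs' := Real.sqrt_ne_zero'.mpr (lt_of_le_of_ne hs (Ne.symm hx))
    refine ⟨((√(∑ i, ‖x i‖ ^ 2) : ℝ) : ℂ)⁻¹ • x, ?_, ?_⟩
    · simp only [Pi.smul_apply, norm_smul, mul_pow, ← Finset.mul_sum, norm_inv, Complex.norm_real,
        inv_pow, Real.norm_eq_abs, sq_abs]
      rw [Real.sq_sqrt hs, inv_mul_cancel₀ hx]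
    · rw [smul_smul, mul_inv_cancel₀ (by exact_mod_cast hs'), one_smul]

/-- The squared concurrence of assistance of a two-qubit state dominates `Tr(ρ ρ̃)`, where `ρ̃` is
the spin-flipped state, written in terms of an arbitrary ensemble realizing `ρ`. -/
theorem sum_norm_sq_spinFlipForm_le_concA_sq {ι : Type*} [Fintype ι] [DecidableEq ι]
    (φ : ι → Fin 2 × Fin 2 → ℂ) (hφ : ∑ i, ∑ x, ‖φ i x‖ ^ 2 = 1) :
    ∑ i, ∑ j, ‖spinFlipForm (φ i) (φ j)‖ ^ 2 ≤ concA (∑ i, pureDM (φ i)) ^ 2 := by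
  obtain ⟨n, b, hb, hsum⟩ := exists_takagi (fun i j => spinFlipForm (φ i) (φ j))
    fun i j => spinFlipForm_comm _ _
  let χ : Fin n → Fin 2 × Fin 2 → ℂ := fun k => ∑ i, b k i • φ i
  have hχ : ∑ k, pureDM (χ k) = ∑ i, pureDM (φ i) := by
    ext x y
    simp only [Matrix.sum_apply, pureDM, χ, Finset.sum_apply, Pi.smul_apply, smul_eq_mul, map_sum,
      map_mul, Finset.sum_mul_sum]
    rw [Finset.sum_comm]
    refine Finset.sum_congr rfl fun i _ => ?_
    rw [Finset.sum_comm]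
    have : ∀ j, ∑ k, b k i * φ i x * (starRingEnd ℂ (b k j) * starRingEnd ℂ (φ j y)) =
        (if i = j then 1 else 0) * (φ i x * starRingEnd ℂ (φ j y)) := by
      intro j
      rw [← hb, Finset.sum_mul]
      exact Finset.sum_congr rfl fun k _ => by ring
    simp [this]
  choose ω hω hDM hconc using fun k => exists_normalized_s1 (χ k)
  have trace_eq : ∀ z : Fin 2 × Fin 2 → ℂ,
      (∑ x, pureDM z x x) = ((∑ x, ‖z x‖ ^ 2 : ℝ) : ℂ) := by
    intro z
    push_cast
    exact Finset.sum_congr rfl fun x _ => Complex.mul_conj' _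
  have hp : ∑ k, ∑ x, ‖χ k x‖ ^ 2 = 1 := by
    rw [← hφ]
    apply Complex.ofReal_injective
    rw [Complex.ofReal_sum, Complex.ofReal_sum]
    simp_rw [← trace_eq]
    rw [Finset.sum_comm, Finset.sum_comm (s := (Finset.univ : Finset ι))]
    simp_rw [← Matrix.sum_apply, hχ]
  have hmem : ∑ k, ‖spinFlipForm (χ k) (χ k)‖ ∈ concSet (∑ i, pureDM (φ i)) := by
    refine ⟨n, fun k => ∑ x, ‖χ k x‖ ^ 2, ω, fun k => by positivity, hp, hω, ?_, ?_⟩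
    · rw [← hχ]
      exact Finset.sum_congr rfl fun k _ => hDM k
    · exact Finset.sum_congr rfl fun k _ => hconc k
  have hle := le_csSup (bddAbove_concSet _) hmem
  rw [hsum]
  simp_rw [← spinFlipForm_sum]
  calc ∑ k, ‖spinFlipForm (χ k) (χ k)‖ ^ 2
      ≤ (∑ k, ‖spinFlipForm (χ k) (χ k)‖) ^ 2 :=
        Finset.sum_sq_le_sq_sum_of_nonneg fun k _ => norm_nonneg _
    _ ≤ concA (∑ i, pureDM (φ i)) ^ 2 := by
        gcongr
        exact hle

/-- Exchange the entries of two configurations on the sites in `S`. -/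
def swapOn {κ : Type*} [DecidableEq κ] (S : Finset κ) (z : (κ → Fin 2) × (κ → Fin 2)) :
    (κ → Fin 2) × (κ → Fin 2) :=
  (S.piecewise z.2 z.1, S.piecewise z.1 z.2)

theorem swapOn_swapOn {κ : Type*} [DecidableEq κ] (S T : Finset κ)
    (z : (κ → Fin 2) × (κ → Fin 2)) : swapOn S (swapOn T z) = swapOn (symmDiff S T) z := by
  ext i <;> by_cases hS : i ∈ S <;> by_cases hT : i ∈ T <;>
    simp [swapOn, Finset.piecewise, Finset.mem_symmDiff, hS, hT]

theorem swapOn_involutive {κ : Type*} [DecidableEq κ] (S : Finset κ) :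
    Function.Involutive (swapOn S) := by
  intro z
  rw [swapOn_swapOn, symmDiff_self]
  simp [swapOn]

/-- The operator on two copies of the system that swaps the copies on the sites in `S`. -/
def swapOp {κ : Type*} [DecidableEq κ] (S : Finset κ) :
    Module.End ℂ ((κ → Fin 2) × (κ → Fin 2) → ℂ) :=
  LinearMap.funLeft ℂ ℂ (swapOn S)

theorem swapOp_mul {κ : Type*} [DecidableEq κ] (S T : Finset κ) :
    swapOp S * swapOp T = swapOp (symmDiff S T) := by
  ext1 f
  funext z
  simp [swapOp, LinearMap.funLeft_apply, swapOn_swapOn, symmDiff_comm]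

theorem swapOp_empty {κ : Type*} [DecidableEq κ] : swapOp (∅ : Finset κ) = 1 := by
  ext1 f
  funext z
  simp [swapOp, LinearMap.funLeft_apply, swapOn]

theorem swapOp_mul_self {κ : Type*} [DecidableEq κ] (S : Finset κ) :
    swapOp S * swapOp S = 1 := by
  rw [swapOp_mul, symmDiff_self]
  exact swapOp_empty

theorem swapOp_commute {κ : Type*} [DecidableEq κ] (S T : Finset κ) :
    Commute (swapOp S) (swapOp T) := by
  rw [Commute, SemiconjBy, swapOp_mul, swapOp_mul, symmDiff_comm]

/-- The real part of the standard Hermitian inner product of two functions. -/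
def rePairing {Z : Type*} [Fintype Z] (f g : Z → ℂ) : ℝ := (∑ z, starRingEnd ℂ (f z) * g z).re

theorem rePairing_add {Z : Type*} [Fintype Z] (f g h : Z → ℂ) :
    rePairing f (g + h) = rePairing f g + rePairing f h := by
  simp [rePairing, mul_add, Finset.sum_add_distrib]

theorem rePairing_sub {Z : Type*} [Fintype Z] (f g h : Z → ℂ) :
    rePairing f (g - h) = rePairing f g - rePairing f h := by
  simp [rePairing, mul_sub, Finset.sum_sub_distrib]

theorem rePairing_sub_left {Z : Type*} [Fintype Z] (f g h : Z → ℂ) :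
    rePairing (f - g) h = rePairing f h - rePairing g h := by
  simp [rePairing, sub_mul, Finset.sum_sub_distrib]

theorem rePairing_self_nonneg {Z : Type*} [Fintype Z] (f : Z → ℂ) : 0 ≤ rePairing f f := by
  rw [rePairing, Complex.re_sum]
  refine Finset.sum_nonneg fun z _ => ?_
  rw [← Complex.normSq_eq_conj_mul_self]
  exact Complex.normSq_nonneg _

theorem rePairing_swapOp {κ : Type*} [Fintype κ] [DecidableEq κ] (S : Finset κ)
    (f g : (κ → Fin 2) × (κ → Fin 2) → ℂ) :
    rePairing (swapOp S f) g = rePairing f (swapOp S g) := by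
  unfold rePairing
  rw [← Equiv.sum_comp (swapOn_involutive S).toPerm]
  simp [swapOp, LinearMap.funLeft_apply, swapOn_involutive S _]

theorem rePairing_one_sub_swapOp {κ : Type*} [Fintype κ] [DecidableEq κ] (S : Finset κ)
    (f g : (κ → Fin 2) × (κ → Fin 2) → ℂ) :
    rePairing ((1 - swapOp S) f) g = rePairing f ((1 - swapOp S) g) := by
  simp only [LinearMap.sub_apply, Module.End.one_apply, rePairing_sub, rePairing_sub_left,
    rePairing_swapOp]

theorem one_sub_swapOp_mul_self {κ : Type*} [DecidableEq κ] (S : Finset κ) :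
    (1 - swapOp S) * (1 - swapOp S) = 2 • (1 - swapOp S) := by
  rw [mul_sub, sub_mul, sub_mul, swapOp_mul_self]
  simp only [one_mul, mul_one]
  abel

theorem one_sub_swapOp_commute {κ : Type*} [DecidableEq κ] (S T : Finset κ) :
    Commute (1 - swapOp S) (1 - swapOp T) :=
  ((Commute.one_left _).sub_left ((Commute.one_right _).sub_right (swapOp_commute S T)))

theorem rePairing_one_sub_swapOp_mul_nonneg {κ : Type*} [Fintype κ] [DecidableEq κ]
    (S T U : Finset κ) (f : (κ → Fin 2) × (κ → Fin 2) → ℂ) :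
    0 ≤ rePairing f (((1 - swapOp U) * (1 - swapOp S) * (1 - swapOp T)) f) := by
  set A := 1 - swapOp U with hA
  set B := 1 - swapOp S with hB
  set C := 1 - swapOp T with hC
  have hAB : B * A = A * B := one_sub_swapOp_commute S U
  have hBC : C * B = B * C := one_sub_swapOp_commute T S
  have hAC : C * A = A * C := one_sub_swapOp_commute T U
  have hsq : C * B * A * (A * B * C) = 8 • (A * B * C) := by
    have h1 : C * B * A = A * B * C := by rw [hBC, mul_assoc, hAC, ← mul_assoc, hAB]
    have hA2 : A * A = 2 • A := one_sub_swapOp_mul_self U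
    have hB2 : B * B = 2 • B := one_sub_swapOp_mul_self S
    have hC2 : C * C = 2 • C := one_sub_swapOp_mul_self T
    calc C * B * A * (A * B * C) = C * (B * (A * A) * B) * C := by simp only [mul_assoc]
      _ = 2 • (C * ((A * B) * B) * C) := by
          rw [hA2, ← hAB]; simp only [mul_smul_comm, smul_mul_assoc]
      _ = 4 • (C * (A * B) * C) := by
          rw [mul_assoc A, hB2]; simp only [mul_smul_comm, smul_mul_assoc, smul_smul]; norm_num
      _ = 4 • (A * B * (C * C)) := by
          rw [← mul_assoc C, hAC, mul_assoc A C, hBC]; simp only [mul_assoc]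
      _ = 8 • (A * B * C) := by
          rw [hC2]; simp only [mul_smul_comm, smul_smul]; norm_num
  have h := rePairing_self_nonneg ((A * B * C) f)
  have h2 : rePairing ((A * B * C) f) ((A * B * C) f) =
      rePairing f ((C * B * A * (A * B * C)) f) := by
    simp only [Module.End.mul_apply]
    rw [hA, rePairing_one_sub_swapOp, hB, rePairing_one_sub_swapOp, hC, rePairing_one_sub_swapOp]
  have h3 : rePairing f ((8 • (A * B * C)) f) = 8 * rePairing f ((A * B * C) f) := by
    simp [rePairing, ← Finset.mul_sum, mul_left_comm]
  rw [h2, hsq, h3] at h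
  linarith

/-- The expectation value of twice-antisymmetrized swaps is subadditive in the swapped region. -/
theorem rePairing_swapOp_le_sum {κ : Type*} [Fintype κ] [DecidableEq κ] (U S : Finset κ)
    (f : (κ → Fin 2) × (κ → Fin 2) → ℂ) :
    rePairing f (((1 - swapOp U) * (1 - swapOp S)) f) ≤
      ∑ v ∈ S, rePairing f (((1 - swapOp U) * (1 - swapOp {v})) f) := by
  induction S using Finset.induction_on with
  | empty => simp [swapOp_empty, rePairing]
  | insert v S hv ih =>
    rw [Finset.sum_insert hv]
    have hins : swapOp (insert v S) = swapOp S * swapOp {v} := by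
      rw [swapOp_mul, Disjoint.symmDiff_eq_sup (by simpa using hv), Finset.insert_eq,
        Finset.union_comm]
      rfl
    have h := rePairing_one_sub_swapOp_mul_nonneg S {v} U f
    have hexp : (1 - swapOp U) * (1 - swapOp S) * (1 - swapOp {v}) =
        (1 - swapOp U) * (1 - swapOp S) + (1 - swapOp U) * (1 - swapOp {v}) -
          (1 - swapOp U) * (1 - swapOp (insert v S)) := by
      rw [hins]
      simp only [mul_sub, sub_mul, mul_one, one_mul, mul_assoc]
      abel
    rw [hexp, LinearMap.sub_apply, LinearMap.add_apply, rePairing_sub, rePairing_add] at h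
    linarith

/-- Two copies of the state `ψ`. -/
def twoCopies {κ : Type*} (ψ : (κ → Fin 2) → ℂ) (z : (κ → Fin 2) × (κ → Fin 2)) : ℂ :=
  ψ z.1 * ψ z.2

theorem rePairing_twoCopies_self {κ : Type*} [Fintype κ] [DecidableEq κ] (ψ : (κ → Fin 2) → ℂ)
    (hψ : ∑ x, ‖ψ x‖ ^ 2 = 1) : rePairing (twoCopies ψ) (twoCopies ψ) = 1 := by
  have h : ∀ x y, starRingEnd ℂ (ψ x * ψ y) * (ψ x * ψ y) =
      ((‖ψ x‖ ^ 2 * ‖ψ y‖ ^ 2 : ℝ) : ℂ) := by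
    intro x y
    rw [Complex.conj_mul', norm_mul]
    push_cast
    ring
  rw [rePairing, Fintype.sum_prod_type]
  simp_rw [twoCopies, h, ← Complex.ofReal_sum, ← Finset.mul_sum, hψ, mul_one]
  rw [hψ, Complex.ofReal_one, Complex.one_re]

theorem swapOp_compl_twoCopies {κ : Type*} [Fintype κ] [DecidableEq κ] (S : Finset κ)
    (ψ : (κ → Fin 2) → ℂ) : swapOp Sᶜ (twoCopies ψ) = swapOp S (twoCopies ψ) := by
  funext z
  simp [swapOp, LinearMap.funLeft_apply, twoCopies, swapOn, Finset.piecewise_compl, mul_comm]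

/-- The expectation value of `(1 - F_u)(1 - F_v)` in two copies of `ψ`. -/
def pairWeight {κ : Type*} [Fintype κ] [DecidableEq κ] (ψ : (κ → Fin 2) → ℂ) (u v : κ) : ℝ :=
  rePairing (twoCopies ψ) (((1 - swapOp {u}) * (1 - swapOp {v})) (twoCopies ψ))

theorem pairWeight_comm {κ : Type*} [Fintype κ] [DecidableEq κ] (ψ : (κ → Fin 2) → ℂ) (u v : κ) :
    pairWeight ψ u v = pairWeight ψ v u := by
  rw [pairWeight, (one_sub_swapOp_commute {u} {v}).eq, pairWeight]

theorem pairWeight_nonneg {κ : Type*} [Fintype κ] [DecidableEq κ] (ψ : (κ → Fin 2) → ℂ)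
    (u v : κ) : 0 ≤ pairWeight ψ u v := by
  have h := rePairing_one_sub_swapOp_mul_nonneg {v} {u} {u} (twoCopies ψ)
  rw [mul_assoc, (one_sub_swapOp_commute {v} {u}).eq, ← mul_assoc, one_sub_swapOp_mul_self,
    smul_mul_assoc, LinearMap.smul_apply, two_nsmul, rePairing_add] at h
  unfold pairWeight
  linarith

theorem rePairing_one_sub_mul_one_sub {κ : Type*} [Fintype κ] [DecidableEq κ] (S T : Finset κ)
    (f : (κ → Fin 2) × (κ → Fin 2) → ℂ) :
    rePairing f (((1 - swapOp S) * (1 - swapOp T)) f) =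
      rePairing f f - rePairing f (swapOp S f) - rePairing f (swapOp T f) +
        rePairing f (swapOp (symmDiff S T) f) := by
  have : (1 - swapOp S) * (1 - swapOp T) = 1 - swapOp S - swapOp T + swapOp (symmDiff S T) := by
    rw [← swapOp_mul]
    simp only [mul_sub, sub_mul, mul_one, one_mul]
    abel
  rw [this]
  simp only [LinearMap.add_apply, LinearMap.sub_apply, Module.End.one_apply, rePairing_add,
    rePairing_sub]

/-- The linear entropy of a single qubit of a pure state is bounded by the sum of pair weights. -/
theorem two_mul_linear_entropy_le_sum_pairWeight {κ : Type*} [Fintype κ] [DecidableEq κ]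
    (ψ : (κ → Fin 2) → ℂ) (hψ : ∑ x, ‖ψ x‖ ^ 2 = 1) (u : κ) :
    2 * (1 - rePairing (twoCopies ψ) (swapOp {u} (twoCopies ψ))) ≤
      ∑ v ∈ ({u}ᶜ : Finset κ), pairWeight ψ u v := by
  have h := rePairing_swapOp_le_sum {u} {u}ᶜ (twoCopies ψ)
  have h' : symmDiff ({u} : Finset κ) {u}ᶜ = ∅ᶜ := by simp
  rw [rePairing_one_sub_mul_one_sub, h', swapOp_compl_twoCopies, swapOp_compl_twoCopies,
    swapOp_empty, Module.End.one_apply, rePairing_twoCopies_self ψ hψ] at h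
  unfold pairWeight
  linarith

/-- Subadditivity of the linear entropy for a pair of sites, combined with the single-site bound. -/
theorem linear_entropy_pair_le {κ : Type*} [Fintype κ] [DecidableEq κ]
    (ψ : (κ → Fin 2) → ℂ) (hψ : ∑ x, ‖ψ x‖ ^ 2 = 1) {u v : κ} (huv : u ≠ v) :
    2 * (1 - rePairing (twoCopies ψ) (swapOp {u, v} (twoCopies ψ))) ≤
      ∑ w ∈ ({u}ᶜ : Finset κ), pairWeight ψ u w + ∑ w ∈ ({v}ᶜ : Finset κ), pairWeight ψ v w := by
  have hu := two_mul_linear_entropy_le_sum_pairWeight ψ hψ u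
  have hv := two_mul_linear_entropy_le_sum_pairWeight ψ hψ v
  have h := pairWeight_nonneg ψ u v
  have hsymm : symmDiff ({u} : Finset κ) {v} = {u, v} := by
    rw [Disjoint.symmDiff_eq_sup (by simpa using huv)]
    rfl
  rw [pairWeight, rePairing_one_sub_mul_one_sub, hsymm, rePairing_twoCopies_self ψ hψ] at h
  linarith

/-- Splitting a configuration into its values at two distinct sites and the rest. -/
def assembleEquiv {N : ℕ} {u v : Fin N} (huv : u ≠ v) :
    ({i : Fin N // i ≠ u ∧ i ≠ v} → Fin 2) × (Fin 2 × Fin 2) ≃ (Fin N → Fin 2) where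
  toFun p := assemble2 u v p.2.1 p.2.2 p.1
  invFun x := (fun i => x i, (x u, x v))
  left_inv p := by
    refine Prod.ext (funext fun i => ?_) (Prod.ext ?_ ?_)
    · simp [assemble2, i.2.1, i.2.2]
    · simp [assemble2]
    · simp [assemble2, huv.symm]
  right_inv x := by
    funext i
    by_cases hu : i = u
    · simp [assemble2, hu]
    · by_cases hv : i = v
      · simp [assemble2, hv, huv.symm]
      · simp [assemble2, hu, hv]

theorem sum_conj_mul_antisymm_eq (x y : Fin 2 × Fin 2 → ℂ) :
    ∑ p : Fin 2 × Fin 2, ∑ q : Fin 2 × Fin 2, starRingEnd ℂ (x p * y q) *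
      (x p * y q - x (q.1, p.2) * y (p.1, q.2) - x (p.1, q.2) * y (q.1, p.2) + x q * y p) =
      ((‖spinFlipForm x y‖ ^ 2 : ℝ) : ℂ) := by
  push_cast
  rw [← Complex.conj_mul']
  simp only [spinFlipForm, Fintype.sum_prod_type, Fin.sum_univ_two, map_mul, map_sub, map_add]
  ring

theorem rePairing_twoCopies_reindex {κ β : Type*} [Fintype κ] [DecidableEq κ] [Fintype β]
    (e : β ≃ (κ → Fin 2)) (ψ : (κ → Fin 2) → ℂ) (G : (κ → Fin 2) × (κ → Fin 2) → ℂ) :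
    rePairing (twoCopies ψ) G =
      (∑ x, ∑ y, starRingEnd ℂ (ψ (e x) * ψ (e y)) * G (e x, e y)).re := by
  rw [rePairing, ← (e.prodCongr e).sum_comp, Fintype.sum_prod_type]
  rfl

theorem swapOn_assemble2 {N : ℕ} {u v : Fin N} (huv : u ≠ v)
    (f g : {i : Fin N // i ≠ u ∧ i ≠ v} → Fin 2) (a b a' b' : Fin 2) :
    swapOn {u} (assemble2 u v a b f, assemble2 u v a' b' g) =
        (assemble2 u v a' b f, assemble2 u v a b' g) ∧
      swapOn {v} (assemble2 u v a b f, assemble2 u v a' b' g) =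
        (assemble2 u v a b' f, assemble2 u v a' b g) := by
  refine ⟨Prod.ext ?_ ?_, Prod.ext ?_ ?_⟩ <;> funext i <;> by_cases hu : i = u <;>
    by_cases hv : i = v <;> simp_all [swapOn, assemble2, Finset.piecewise]

theorem pairWeight_eq_sum {N : ℕ} (ψ : (Fin N → Fin 2) → ℂ) {u v : Fin N} (huv : u ≠ v) :
    pairWeight ψ u v = ∑ f, ∑ g,
      ‖spinFlipForm (fun p => ψ (assemble2 u v p.1 p.2 f))
        (fun p => ψ (assemble2 u v p.1 p.2 g))‖ ^ 2 := by
  rw [pairWeight, rePairing_twoCopies_reindex (assembleEquiv huv), ← Complex.ofReal_re (∑ f, _)]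
  congr 1
  push_cast
  rw [Fintype.sum_prod_type]
  refine Finset.sum_congr rfl fun f _ => ?_
  simp_rw [Fintype.sum_prod_type
    (f := fun y : ({i : Fin N // i ≠ u ∧ i ≠ v} → Fin 2) × (Fin 2 × Fin 2) => _)]
  rw [Finset.sum_comm]
  refine Finset.sum_congr rfl fun g _ => ?_
  rw [← Complex.ofReal_pow, ← sum_conj_mul_antisymm_eq]
  refine Finset.sum_congr rfl fun p _ => Finset.sum_congr rfl fun q _ => ?_
  simp only [assembleEquiv, Equiv.coe_fn_mk, Module.End.mul_apply, LinearMap.sub_apply,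
    Module.End.one_apply, Pi.sub_apply, swapOp, LinearMap.funLeft_apply,
    (swapOn_assemble2 huv _ _ _ _ _ _).1, (swapOn_assemble2 huv _ _ _ _ _ _).2, twoCopies]
  ring

theorem pairWeight_le_concA_sq {N : ℕ} (ψ : (Fin N → Fin 2) → ℂ) (hψ : ∑ x, ‖ψ x‖ ^ 2 = 1)
    {u v : Fin N} (huv : u ≠ v) : pairWeight ψ u v ≤ concA (rdm2 u v ψ) ^ 2 := by
  have hρ : rdm2 u v ψ = ∑ f, pureDM fun p : Fin 2 × Fin 2 => ψ (assemble2 u v p.1 p.2 f) := by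
    ext x y
    simp [rdm2, pureDM, Matrix.sum_apply]
  rw [pairWeight_eq_sum ψ huv, hρ]
  refine sum_norm_sq_spinFlipForm_le_concA_sq _ ?_
  rw [← hψ, ← (assembleEquiv huv).sum_comp, Fintype.sum_prod_type]
  rfl

theorem trSq_ptraceRight_pureDM {S T : Type*} [Fintype S] [Fintype T] (φ : S × T → ℂ) :
    trSq (ptraceRight (pureDM φ)) =
      (∑ x, ∑ y, starRingEnd ℂ (φ x * φ y) * (φ (y.1, x.2) * φ (x.1, y.2))).re := by
  simp only [trSq, ptraceRight, pureDM, Matrix.trace, Matrix.diag, Matrix.mul_apply,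
    Fintype.sum_prod_type, Finset.sum_mul_sum]
  congr 1
  refine Finset.sum_congr rfl fun s _ => ?_
  rw [Finset.sum_comm (γ := T)]
  refine Finset.sum_congr rfl fun s' _ => ?_
  rw [Finset.sum_comm]
  refine Finset.sum_congr rfl fun t _ => Finset.sum_congr rfl fun t' _ => ?_
  simp only [map_mul]
  ring

theorem qubitCut_sq_le {N : ℕ} (P : Fin N → Prop) [DecidablePred P] (ψ : (Fin N → Fin 2) → ℂ) :
    qubitCut P ψ ^ 2 ≤ max 0
      (2 * (1 - rePairing (twoCopies ψ) (swapOp (Finset.univ.filter P) (twoCopies ψ)))) := by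
  have h : trSq (ptraceRight (pureDM fun x : ({i // P i} → Fin 2) × ({i // ¬ P i} → Fin 2) =>
      ψ ((Equiv.piEquivPiSubtypeProd P (fun _ => Fin 2)).symm x))) =
      rePairing (twoCopies ψ) (swapOp (Finset.univ.filter P) (twoCopies ψ)) := by
    rw [trSq_ptraceRight_pureDM,
      rePairing_twoCopies_reindex (Equiv.piEquivPiSubtypeProd P fun _ => Fin 2).symm]
    congr 1
    refine Finset.sum_congr rfl fun x _ => Finset.sum_congr rfl fun y _ => ?_
    congr 1
    simp only [swapOp, LinearMap.funLeft_apply, twoCopies]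
    congr 2 <;> funext i <;> by_cases hi : P i <;>
      simp [swapOn, Finset.piecewise, Equiv.piEquivPiSubtypeProd, hi]
  rw [qubitCut, pureConc, h, Real.sq_sqrt', max_comm]

/-- Theorem 2 of the paper: generalized monogamy upper bound for the
concurrence of an `N`-qubit pure state across the cut `AB | C₁…C_{N-2}`.
Qubits: `A = 0`, `B = 1`, `C_i = i + 1`. -/
theorem theorem2_generalized_monogamy_upper
    (N : ℕ) (hN : 3 ≤ N) (ψ : (Fin N → Fin 2) → ℂ)
    (hψ : ∑ x, ‖ψ x‖ ^ 2 = 1) :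
    (qubitCut (fun i : Fin N => (i : ℕ) < 2) ψ) ^ 2 ≤
      2 * (concA (rdm2 (⟨0, by omega⟩ : Fin N) (⟨1, by omega⟩ : Fin N) ψ)) ^ 2 +
        ∑ i : Fin (N - 2),
          ((concA (rdm2 (⟨0, by omega⟩ : Fin N) (⟨(i : ℕ) + 2, by have := i.isLt; omega⟩ : Fin N) ψ)) ^ 2 +
            (concA (rdm2 (⟨1, by omega⟩ : Fin N) (⟨(i : ℕ) + 2, by have := i.isLt; omega⟩ : Fin N) ψ)) ^ 2) := by
  obtain ⟨M, rfl⟩ : ∃ M, N = M + 2 := ⟨N - 2, by omega⟩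
  have h01 : (0 : Fin (M + 2)) ≠ 1 := by simp
  have hcut := qubitCut_sq_le (fun i : Fin (M + 2) => (i : ℕ) < 2) ψ
  have hfilter : Finset.univ.filter (fun i : Fin (M + 2) => (i : ℕ) < 2) = {0, 1} := by
    ext i
    simp only [Finset.mem_filter, Finset.mem_univ, true_and, Finset.mem_insert,
      Finset.mem_singleton, Fin.ext_iff, Fin.val_zero, Fin.val_one]
    omega
  rw [hfilter] at hcut
  have hpair := linear_entropy_pair_le ψ hψ h01
  have hsum : ∀ (u : Fin (M + 2)), ∑ w ∈ ({u}ᶜ : Finset _), pairWeight ψ u w =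
      pairWeight ψ u 0 + (pairWeight ψ u 1 + ∑ i : Fin M, pairWeight ψ u i.succ.succ) -
        pairWeight ψ u u := by
    intro u
    have h := Finset.sum_compl_add_sum {u} (pairWeight ψ u)
    rw [Finset.sum_singleton, Fin.sum_univ_succ, Fin.sum_univ_succ] at h
    rw [← Fin.succ_zero_eq_one, ← h, add_sub_cancel_right]
  rw [hsum, hsum, pairWeight_comm ψ 1 0] at hpair
  have hAB := pairWeight_le_concA_sq ψ hψ h01
  have hA : ∑ i : Fin M, pairWeight ψ 0 i.succ.succ ≤
      ∑ i : Fin M, concA (rdm2 0 i.succ.succ ψ) ^ 2 :=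
    Finset.sum_le_sum fun i _ => pairWeight_le_concA_sq ψ hψ (Fin.succ_ne_zero _).symm
  have hB : ∑ i : Fin M, pairWeight ψ 1 i.succ.succ ≤
      ∑ i : Fin M, concA (rdm2 1 i.succ.succ ψ) ^ 2 :=
    Finset.sum_le_sum fun i _ => pairWeight_le_concA_sq ψ hψ 
      ((Fin.succ_injective _).ne (Fin.succ_ne_zero i).symm)
  change _ ≤ 2 * concA (rdm2 0 1 ψ) ^ 2 + ∑ i : Fin M,
    (concA (rdm2 0 i.succ.succ ψ) ^ 2 + concA (rdm2 1 i.succ.succ ψ) ^ 2)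
  rw [Finset.sum_add_distrib]
  have hnonneg : 0 ≤ pairWeight ψ 0 0 ∧ 0 ≤ pairWeight ψ 1 1 :=
    ⟨pairWeight_nonneg ψ 0 0, pairWeight_nonneg ψ 1 1⟩
  refine hcut.trans (max_le ?_ ?_)
  · exact add_nonneg (mul_nonneg zero_le_two (sq_nonneg _)) (add_nonneg
      (Finset.sum_nonneg fun i _ => sq_nonneg _) (Finset.sum_nonneg fun i _ => sq_nonneg _))
  · linarith

end
end

section
/- For any N-qubit pure state |ψ⟩ on qubits A, B, C₁, …, C_{N−2} (N ≥ 3), the squared concurrence across the cut AB versus C₁…C_{N−2} satisfies the lower bound C²(|ψ⟩_{AB|C₁…C_{N−2}}) ≥ | C²(|ψ⟩_{A|BC₁…C_{N−2}}) − C²(|ψ⟩_{B|AC₁…C_{N−2}}) |. -/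
open scoped BigOperators

noncomputable section

/-- Exchange the coordinates satisfying `P` between the two configurations of a pair. -/
def swapCoords {ι α : Type*} (P : ι → Prop) [DecidablePred P] (p : (ι → α) × (ι → α)) :
    (ι → α) × (ι → α) :=
  (fun i => if P i then p.2 i else p.1 i, fun i => if P i then p.1 i else p.2 i)

theorem swapCoords_involutive {ι α : Type*} (P : ι → Prop) [DecidablePred P] :
    Function.Involutive (swapCoords (α := α) P) := by
  intro p
  ext i <;> by_cases h : P i <;> simp [swapCoords, h]

theorem swapCoords_swapCoords {ι α : Type*} (P Q R : ι → Prop) [DecidablePred P]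
    [DecidablePred Q] [DecidablePred R] (h : ∀ i, R i ↔ Xor (P i) (Q i))
    (p : (ι → α) × (ι → α)) : swapCoords P (swapCoords Q p) = swapCoords R p := by
  ext i <;> by_cases hP : P i <;> by_cases hQ : Q i <;> simp [swapCoords, hP, hQ, h, Xor]

/-- The overlap of `Φ` with its composite with `s`. -/
def permOverlap {X : Type*} [Fintype X] (Φ : X → ℂ) (s : X → X) : ℝ :=
  (∑ p, Φ p * (starRingEnd ℂ) (Φ (s p))).re

/-- The product of the positive operators `1 - s` and `1 - t`, for commuting involutions `s` and
`t`, has nonnegative expectation. -/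
theorem permOverlap_add_le {X : Type*} [Fintype X] (Φ : X → ℂ) (s t u : X → X)
    (hs : Function.Involutive s) (ht : Function.Involutive t)
    (hst : ∀ p, s (t p) = u p) (hts : ∀ p, t (s p) = u p) :
    permOverlap Φ s + permOverlap Φ t ≤ permOverlap Φ id + permOverlap Φ u := by
  let D : X → ℂ := fun p => Φ p - Φ (s p) - Φ (t p) + Φ (u p)
  let c : X → ℂ := fun p => Φ p * (starRingEnd ℂ) (D p)
  have hsu (p : X) : u (s p) = t p := by rw [← hts, hs]
  have htu (p : X) : u (t p) = s p := by rw [← hst, ht]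
  have hDs (p : X) : D (s p) = -D p := by
    simp only [D, hs p, hts, hsu]; ring
  have hDt (p : X) : D (t p) = -D p := by
    simp only [D, ht p, hst, htu]; ring
  have hDu (p : X) : D (u p) = D p := by
    rw [← hst, hDs, hDt, neg_neg]
  have hus : Function.Involutive u := fun p => by rw [← hst (u p), ← hts p, ht, hs]
  have hsum (v : X → X) (hv : Function.Involutive v) : ∑ p, c (v p) = ∑ p, c p :=
    Equiv.sum_comp hv.toPerm c
  have hnorm : ∑ p, D p * (starRingEnd ℂ) (D p) = 4 * ∑ p, c p := by
    calc ∑ p, D p * (starRingEnd ℂ) (D p) = ∑ p, (c p + c (s p) + c (t p) + c (u p)) := by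
          refine Finset.sum_congr rfl fun p _ => ?_
          simp only [c, hDs, hDt, hDu, map_neg]
          simp only [D]; ring
      _ = 4 * ∑ p, c p := by
          simp only [Finset.sum_add_distrib, hsum s hs, hsum t ht, hsum u hus]; ring
  have hnonneg : 0 ≤ (∑ p, D p * (starRingEnd ℂ) (D p)).re := by
    rw [Complex.re_sum]
    refine Finset.sum_nonneg fun p _ => ?_
    rw [Complex.mul_conj, Complex.ofReal_re]
    exact Complex.normSq_nonneg _
  have hc : (∑ p, c p).re =
      permOverlap Φ id - permOverlap Φ s - permOverlap Φ t + permOverlap Φ u := by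
    simp only [permOverlap, ← Complex.sub_re, ← Complex.add_re, ← Finset.sum_sub_distrib,
      ← Finset.sum_add_distrib]
    congr 1
    refine Finset.sum_congr rfl fun p _ => ?_
    simp only [c, D, map_add, map_sub, id]; ring
  rw [hnorm] at hnonneg
  have h4 : (4 * ∑ p, c p).re = 4 * (∑ p, c p).re := by simp
  linarith

theorem trSq_ptraceRight_pureDM_s2 {S T : Type*} [Fintype S] [Fintype T] (f : S × T → ℂ) :
    trSq (ptraceRight (pureDM f)) =
      (∑ p : S × T, ∑ q : S × T, f p * f q *
        (starRingEnd ℂ) (f (q.1, p.2) * f (p.1, q.2))).re := by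
  simp only [trSq, Matrix.trace, Matrix.diag, Matrix.mul_apply, ptraceRight, pureDM,
    Fintype.sum_prod_type, Finset.sum_mul_sum]
  congr 1
  refine Finset.sum_congr rfl fun s _ => ?_
  rw [Finset.sum_comm]
  refine Finset.sum_congr rfl fun t _ => Finset.sum_congr rfl fun s' _ =>
    Finset.sum_congr rfl fun t' _ => ?_
  rw [map_mul]; ring

/-- The pair state `ψ ⊗ ψ`. -/
def pairState {X : Type*} (ψ : X → ℂ) (p : X × X) : ℂ := ψ p.1 * ψ p.2

theorem qubitCut_eq_sqrt {N : ℕ} (P : Fin N → Prop) [DecidablePred P]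
    (ψ : (Fin N → Fin 2) → ℂ) :
    qubitCut P ψ = √(2 * (1 - permOverlap (pairState ψ) (swapCoords P))) := by
  rw [qubitCut, pureConc, trSq_ptraceRight_pureDM_s2, permOverlap,
    Fintype.sum_prod_type (fun p : (Fin N → Fin 2) × (Fin N → Fin 2) => _)]
  let e := Equiv.piEquivPiSubtypeProd P (fun _ : Fin N => Fin 2)
  rw [← Equiv.sum_comp e]
  congr 4
  refine Finset.sum_congr rfl fun x _ => ?_
  rw [← Equiv.sum_comp e]
  refine Finset.sum_congr rfl fun y _ => ?_
  have hx : e.symm ((e y).1, (e x).2) = (swapCoords P (x, y)).1 := by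
    ext i; by_cases h : P i <;> simp [e, swapCoords, h]
  have hy : e.symm ((e x).1, (e y).2) = (swapCoords P (x, y)).2 := by
    ext i; by_cases h : P i <;> simp [e, swapCoords, h]
  change ψ (e.symm (e x)) * ψ (e.symm (e y)) * (starRingEnd ℂ)
    (ψ (e.symm ((e y).1, (e x).2)) * ψ (e.symm ((e x).1, (e y).2))) = _
  rw [e.symm_apply_apply, e.symm_apply_apply, hx, hy]
  rfl

theorem permOverlap_pairState_id {X : Type*} [Fintype X] (ψ : X → ℂ) :
    permOverlap (pairState ψ) id = (∑ x, ‖ψ x‖ ^ 2) ^ 2 := by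
  rw [permOverlap, Complex.re_sum, sq, Finset.sum_mul_sum, Fintype.sum_prod_type]
  refine Finset.sum_congr rfl fun x _ => Finset.sum_congr rfl fun y _ => ?_
  rw [id, Complex.mul_conj, Complex.ofReal_re, pairState, Complex.normSq_mul,
    Complex.normSq_eq_norm_sq, Complex.normSq_eq_norm_sq]

theorem abs_sq_sqrt_sub_sq_sqrt_le {x y z : ℝ} (h₁ : y ≤ x + z) (h₂ : z ≤ x + y) :
    |√y ^ 2 - √z ^ 2| ≤ √x ^ 2 := by
  rw [Real.sq_sqrt', Real.sq_sqrt', Real.sq_sqrt']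
  exact (abs_max_sub_max_le_abs y z 0).trans
    ((abs_le.2 ⟨by linarith, by linarith⟩).trans (le_max_left x 0))

/-- The squared concurrence across `AB | C₁…C_{N-2}` is at least the absolute
difference of the squared concurrences across `A | BC₁…C_{N-2}` and
`B | AC₁…C_{N-2}`.  Qubits: `A = 0`, `B = 1`. -/
theorem cut_AB_lower_abs_difference
    (N : ℕ) (hN : 3 ≤ N) (ψ : (Fin N → Fin 2) → ℂ)
    (hψ : ∑ x, ‖ψ x‖ ^ 2 = 1) :
    (qubitCut (fun i : Fin N => (i : ℕ) < 2) ψ) ^ 2 ≥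
      |(qubitCut (fun i : Fin N => i = (⟨0, by omega⟩ : Fin N)) ψ) ^ 2 -
        (qubitCut (fun i : Fin N => i = (⟨1, by omega⟩ : Fin N)) ψ) ^ 2| := by
  have hid : permOverlap (pairState ψ) id = 1 := by
    rw [permOverlap_pairState_id, hψ, one_pow]
  simp only [qubitCut_eq_sqrt]
  have hA := permOverlap_add_le (pairState ψ)
    (swapCoords fun i : Fin N => (i : ℕ) < 2) (swapCoords fun i : Fin N => i = ⟨1, by omega⟩)
    (swapCoords fun i : Fin N => i = ⟨0, by omega⟩)
    (swapCoords_involutive _) (swapCoords_involutive _)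
    (swapCoords_swapCoords _ _ _ fun i => by simp only [Xor, Fin.ext_iff]; omega)
    (swapCoords_swapCoords _ _ _ fun i => by simp only [Xor, Fin.ext_iff]; omega)
  have hB := permOverlap_add_le (pairState ψ)
    (swapCoords fun i : Fin N => (i : ℕ) < 2) (swapCoords fun i : Fin N => i = ⟨0, by omega⟩)
    (swapCoords fun i : Fin N => i = ⟨1, by omega⟩)
    (swapCoords_involutive _) (swapCoords_involutive _)
    (swapCoords_swapCoords _ _ _ fun i => by simp only [Xor, Fin.ext_iff]; omega)
    (swapCoords_swapCoords _ _ _ fun i => by simp only [Xor, Fin.ext_iff]; omega)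
  exact abs_sq_sqrt_sub_sq_sqrt_le (by linarith) (by linarith)


end
end

section
/- For any N-qubit pure state |ψ⟩ on qubits A, B, C₁, …, C_{N−2} (N ≥ 3), the squared concurrence across the cut AB versus C₁…C_{N−2} satisfies the upper bound C²(|ψ⟩_{AB|C₁…C_{N−2}}) ≤ C²(|ψ⟩_{A|BC₁…C_{N−2}}) + C²(|ψ⟩_{B|AC₁…C_{N−2}}). -/
open scoped BigOperators

noncomputable section

/-- Exchange the coordinates satisfying `P` between two configurations. -/
def exchange {ι α : Type*} (P : ι → Prop) [DecidablePred P] (p : (ι → α) × (ι → α)) :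
    (ι → α) × (ι → α) :=
  (fun i => if P i then p.2 i else p.1 i, fun i => if P i then p.1 i else p.2 i)

lemma exchange_involutive {ι α : Type*} (P : ι → Prop) [DecidablePred P] :
    Function.Involutive (exchange (α := α) P) := by
  intro p
  ext i <;> by_cases h : P i <;> simp [exchange, h]

lemma exchange_comm {ι α : Type*} (P Q : ι → Prop) [DecidablePred P] [DecidablePred Q]
    (p : (ι → α) × (ι → α)) :
    exchange P (exchange Q p) = exchange Q (exchange P p) := by
  ext i <;> by_cases h : P i <;> by_cases h' : Q i <;> simp [exchange, h, h']

lemma exchange_or {ι α : Type*} (P Q R : ι → Prop)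
    [DecidablePred P] [DecidablePred Q] [DecidablePred R]
    (hPQ : ∀ i, P i → ¬ Q i) (hR : ∀ i, R i ↔ P i ∨ Q i) (p : (ι → α) × (ι → α)) :
    exchange R p = exchange P (exchange Q p) := by
  ext i <;> by_cases h : P i
  · simp [exchange, hR, h, hPQ i h]
  · simp [exchange, hR, h]
  · simp [exchange, hR, h, hPQ i h]
  · simp [exchange, hR, h]

/-- The purity of a marginal of a pure state, as a correlation between `ψ ⊗ ψ` and its image under
the partial exchange of the two copies. -/
lemma trSq_marginal_eq_exchange {N : ℕ} (P : Fin N → Prop) [DecidablePred P]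
    (ψ : (Fin N → Fin 2) → ℂ) :
    trSq (ptraceRight (pureDM
      (fun x : ({i // P i} → Fin 2) × ({i // ¬ P i} → Fin 2) =>
        ψ ((Equiv.piEquivPiSubtypeProd P (fun _ => Fin 2)).symm x)))) =
    (∑ p : (Fin N → Fin 2) × (Fin N → Fin 2),
      ψ p.1 * ψ p.2 *
        (starRingEnd ℂ) (ψ (exchange P p).1 * ψ (exchange P p).2)).re := by
  set e := Equiv.piEquivPiSubtypeProd P (fun _ => Fin 2) with he
  have hex : ∀ s s' t t', exchange P (e.symm (s, t), e.symm (s', t')) =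
      (e.symm (s', t), e.symm (s, t')) := by
    intro s s' t t'
    ext i <;> by_cases h : P i <;> simp [exchange, he, Equiv.piEquivPiSubtypeProd, h]
  unfold trSq
  congr 1
  rw [← (e.symm.prodCongr e.symm).sum_comp]
  simp only [Fintype.sum_prod_type, Equiv.prodCongr_apply, Prod.map_apply, hex, Matrix.trace,
    Matrix.diag, Matrix.mul_apply, ptraceRight, pureDM, Finset.sum_mul_sum]
  refine Finset.sum_congr rfl fun s _ => ?_
  conv_rhs => rw [Finset.sum_comm]
  refine Finset.sum_congr rfl fun s' _ => Finset.sum_congr rfl fun t _ =>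
    Finset.sum_congr rfl fun t' _ => ?_
  simp only [map_mul]
  ring

lemma sum_sub_comp_mul_conj {α : Type*} [Fintype α] {σ : α → α}
    (hσ : Function.Involutive σ) (F G : α → ℂ) :
    ∑ x, (F x - F (σ x)) * (starRingEnd ℂ) (G x - G (σ x)) =
      2 * ∑ x, F x * (starRingEnd ℂ) (G x - G (σ x)) := by
  have h : ∑ x, F (σ x) * (starRingEnd ℂ) (G x - G (σ x)) =
      -∑ x, F x * (starRingEnd ℂ) (G x - G (σ x)) := by
    rw [← Equiv.sum_comp hσ.toPerm, ← Finset.sum_neg_distrib]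
    refine Finset.sum_congr rfl fun x _ => ?_
    simp only [Function.Involutive.coe_toPerm, hσ x, map_sub]
    ring
  simp only [sub_mul, Finset.sum_sub_distrib, h]
  ring

/-- The antisymmetrization under two commuting involutions is a positive operator. -/
lemma re_sum_antisymm_nonneg {α : Type*} [Fintype α] {σ τ : α → α}
    (hσ : Function.Involutive σ) (hτ : Function.Involutive τ)
    (hστ : ∀ x, σ (τ x) = τ (σ x)) (F : α → ℂ) :
    0 ≤ (∑ x, F x * (starRingEnd ℂ)
      (F x - F (σ x) - (F (τ x) - F (σ (τ x))))).re := by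
  set D : α → ℂ := fun x => F x - F (σ x) - (F (τ x) - F (σ (τ x))) with hD
  have h₁ : ∑ x, D x * (starRingEnd ℂ) (D x) =
      2 * ∑ x, (F x - F (σ x)) * (starRingEnd ℂ) (D x) :=
    sum_sub_comp_mul_conj hτ (fun x => F x - F (σ x)) (fun x => F x - F (σ x))
  have h₂ : ∑ x, (F x - F (σ x)) * (starRingEnd ℂ) (D x) =
      2 * ∑ x, F x * (starRingEnd ℂ) (D x) := by
    have hD' : ∀ x, D x = (F x - F (τ x)) - (F (σ x) - F (τ (σ x))) := by
      intro x
      simp only [hD, hστ]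
      ring
    simp only [hD']
    exact sum_sub_comp_mul_conj hσ F (fun x => F x - F (τ x))
  have h₃ : 0 ≤ (∑ x, D x * (starRingEnd ℂ) (D x)).re := by
    rw [Complex.re_sum]
    refine Finset.sum_nonneg fun x _ => ?_
    rw [Complex.mul_conj, Complex.ofReal_re]
    exact Complex.normSq_nonneg _
  rw [h₁, h₂] at h₃
  have h₄ : (2 * (2 * ∑ x, F x * (starRingEnd ℂ) (D x))).re =
      4 * (∑ x, F x * (starRingEnd ℂ) (D x)).re := by
    simp
    ring
  linarith

lemma sum_tensor_mul_conj {α : Type*} [Fintype α] (ψ : α → ℂ)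
    (hψ : ∑ x, ‖ψ x‖ ^ 2 = 1) :
    ∑ p : α × α, ψ p.1 * ψ p.2 * (starRingEnd ℂ) (ψ p.1 * ψ p.2) = 1 := by
  have h : ∑ x, ψ x * (starRingEnd ℂ) (ψ x) = 1 := by
    simp only [Complex.mul_conj']
    exact_mod_cast hψ
  calc _ = (∑ x, ψ x * (starRingEnd ℂ) (ψ x)) * ∑ x, ψ x * (starRingEnd ℂ) (ψ x) := by
        rw [Finset.sum_mul_sum, Fintype.sum_prod_type]
        refine Finset.sum_congr rfl fun x _ => Finset.sum_congr rfl fun y _ => ?_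
        simp only [map_mul]
        ring
    _ = 1 := by rw [h, one_mul]

/-- Subadditivity of the squared concurrence over disjoint sets of qubits. -/
lemma qubitCut_sq_subadditive {N : ℕ} (P Q R : Fin N → Prop)
    [DecidablePred P] [DecidablePred Q] [DecidablePred R]
    (hPQ : ∀ i, P i → ¬ Q i) (hR : ∀ i, R i ↔ P i ∨ Q i)
    (ψ : (Fin N → Fin 2) → ℂ) (hψ : ∑ x, ‖ψ x‖ ^ 2 = 1) :
    qubitCut R ψ ^ 2 ≤ qubitCut P ψ ^ 2 + qubitCut Q ψ ^ 2 := by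
  have key := re_sum_antisymm_nonneg (exchange_involutive (α := Fin 2) P)
    (exchange_involutive Q) (exchange_comm P Q) (fun p => ψ p.1 * ψ p.2)
  simp only [← exchange_or P Q R hPQ hR, map_sub, mul_sub, Finset.sum_sub_distrib,
    sum_tensor_mul_conj ψ hψ, Complex.sub_re, Complex.one_re,
    ← trSq_marginal_eq_exchange] at key
  unfold qubitCut pureConc
  simp only [Real.sq_sqrt']
  refine max_le (le_trans ?_ (add_le_add (le_max_left _ _) (le_max_left _ _)))
    (add_nonneg (le_max_right _ _) (le_max_right _ _))
  linarith

/-- The squared concurrence across `AB | C₁…C_{N-2}` is at most the sum of the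
squared concurrences across `A | BC₁…C_{N-2}` and `B | AC₁…C_{N-2}`.
Qubits: `A = 0`, `B = 1`. -/
theorem cut_AB_upper_sum
    (N : ℕ) (hN : 3 ≤ N) (ψ : (Fin N → Fin 2) → ℂ)
    (hψ : ∑ x, ‖ψ x‖ ^ 2 = 1) :
    (qubitCut (fun i : Fin N => (i : ℕ) < 2) ψ) ^ 2 ≤
      (qubitCut (fun i : Fin N => i = (⟨0, by omega⟩ : Fin N)) ψ) ^ 2 +
        (qubitCut (fun i : Fin N => i = (⟨1, by omega⟩ : Fin N)) ψ) ^ 2 := by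
  exact qubitCut_sq_subadditive _ _ _ (fun i => by simp only [Fin.ext_iff]; omega)
    (fun i => by simp only [Fin.ext_iff]; omega) ψ hψ

end
end
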